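/- arXiv:0907.1805 — 6 statements merged into one kernel-verified Lean document; each statement's English description precedes it below -/
import Mathlib

section
/- Let G be a countable connected graph in which every vertex has degree at most d, and let T be a positive integer. Then G contains a matching M that has no k-augmenting paths for any k ≤ T. -/
/-- `M` is a matching in the simple graph `G`: a set of edges of `G`, no two of
which share a vertex. -/
def IsGraphMatching {V : Type*} (G : SimpleGraph V) (M : Set (Sym2 V)) : Prop :=
  M ⊆ G.edgeSet ∧ ∀ e ∈ M, ∀ f ∈ M, e ≠ f → ∀ v : V, v ∈ e → v ∉ f

/-- The set of vertices matched by (i.e. that are endpoints of an edge of) `M`. -/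
def matchedSet {V : Type*} (M : Set (Sym2 V)) : Set V := {v | ∃ e ∈ M, v ∈ e}

/-- `p 0, p 1, …, p (2k+1)` is a `k`-augmenting path for the matching `M` in `G`:
the vertices are distinct, consecutive vertices are adjacent, even-indexed edges
are outside `M`, odd-indexed edges are in `M`, and both endpoints are unmatched. -/
def IsAugPath {V : Type*} (G : SimpleGraph V) (M : Set (Sym2 V)) (k : ℕ) (p : ℕ → V) : Prop :=
  (∀ i ≤ 2 * k + 1, ∀ j ≤ 2 * k + 1, p i = p j → i = j) ∧
  (∀ i < 2 * k + 1, G.Adj (p i) (p (i + 1))) ∧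
  (∀ j ≤ k, s(p (2 * j), p (2 * j + 1)) ∉ M) ∧
  (∀ j < k, s(p (2 * j + 1), p (2 * j + 2)) ∈ M) ∧
  p 0 ∉ matchedSet M ∧ p (2 * k + 1) ∉ matchedSet M

/-- Swapping the edges of an augmenting path yields a larger matching. -/
theorem IsAugPath.exists_larger {V : Type*} {G : SimpleGraph V} {S : Finset V}
    {M : Finset (Sym2 V)} {k : ℕ} {p : ℕ → V} (hp : IsAugPath G (M : Set (Sym2 V)) k p)
    (hM : IsGraphMatching G (M : Set (Sym2 V))) (hMS : M ⊆ S.sym2)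
    (hpS : ∀ i ≤ 2 * k + 1, p i ∈ S) :
    ∃ M' : Finset (Sym2 V), M' ⊆ S.sym2 ∧ IsGraphMatching G (M' : Set (Sym2 V)) ∧
      M.card < M'.card := by
  classical
  obtain ⟨hinj, hadj, hout, hin, h0, hend⟩ := hp
  set A := (Finset.range (k + 1)).image fun j ↦ s(p (2 * j), p (2 * j + 1)) with hA
  set B := (Finset.range k).image fun j ↦ s(p (2 * j + 1), p (2 * j + 2)) with hB
  have hAmem : ∀ e ∈ A, ∃ j ≤ k, e = s(p (2 * j), p (2 * j + 1)) := by
    intro e he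
    obtain ⟨j, hj, rfl⟩ := Finset.mem_image.1 he
    exact ⟨j, Nat.lt_succ_iff.1 (Finset.mem_range.1 hj), rfl⟩
  have hAcard : A.card = k + 1 := by
    rw [hA, Finset.card_image_of_injOn, Finset.card_range]
    intro a ha b hb hab
    simp only [Finset.coe_range, Set.mem_Iio] at ha hb
    rcases Sym2.eq_iff.1 hab with ⟨h, -⟩ | ⟨h, -⟩
    · have := hinj _ (by omega) _ (by omega) h
      omega
    · have := hinj _ (by omega) _ (by omega) h
      omega
  have hBcard : B.card ≤ k := Finset.card_image_le.trans (Finset.card_range k).le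
  have hdisj : Disjoint (M \ B) A := by
    rw [Finset.disjoint_left]
    intro e he heA
    obtain ⟨j, hj, rfl⟩ := hAmem e heA
    exact hout j hj (Finset.mem_coe.2 (Finset.mem_sdiff.1 he).1)
  have hpath : ∀ e ∈ M \ B, ∀ i ≤ 2 * k + 1, p i ∉ e := by
    intro e he i hi hie
    obtain ⟨heM, heB⟩ := Finset.mem_sdiff.1 he
    rcases Nat.eq_zero_or_pos i with rfl | hi0
    · exact h0 ⟨e, heM, hie⟩
    rcases hi.eq_or_lt with rfl | hi1
    · exact hend ⟨e, heM, hie⟩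
    obtain ⟨j, hj, hij⟩ : ∃ j < k, i = 2 * j + 1 ∨ i = 2 * j + 2 :=
      ⟨(i - 1) / 2, by omega, by omega⟩
    have hbB : s(p (2 * j + 1), p (2 * j + 2)) ∈ B :=
      Finset.mem_image.2 ⟨j, Finset.mem_range.2 hj, rfl⟩
    refine hM.2 e heM _ (hin j hj) (fun h ↦ heB (h ▸ hbB)) (p i) hie ?_
    rcases hij with rfl | rfl <;> simp
  have hAM : ∀ e ∈ A, ∀ v ∈ e, ∃ i ≤ 2 * k + 1, v = p i := by
    intro e he v hv
    obtain ⟨j, hj, rfl⟩ := hAmem e he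
    rcases Sym2.mem_iff.1 hv with rfl | rfl
    · exact ⟨_, by omega, rfl⟩
    · exact ⟨_, by omega, rfl⟩
  refine ⟨(M \ B) ∪ A, ?_, ⟨?_, ?_⟩, ?_⟩
  · refine Finset.union_subset (Finset.sdiff_subset.trans hMS) fun e he ↦ ?_
    refine Finset.mem_sym2_iff.2 fun v hv ↦ ?_
    obtain ⟨i, hi, rfl⟩ := hAM e he v hv
    exact hpS i hi
  · intro e he
    rcases Finset.mem_union.1 (Finset.mem_coe.1 he) with he | he
    · exact hM.1 (Finset.mem_sdiff.1 he).1
    · obtain ⟨j, hj, rfl⟩ := hAmem e he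
      exact hadj _ (by omega)
  · intro e he f hf hef v hve hvf
    rcases Finset.mem_union.1 (Finset.mem_coe.1 he) with he | he <;>
      rcases Finset.mem_union.1 (Finset.mem_coe.1 hf) with hf | hf
    · exact hM.2 e (Finset.mem_sdiff.1 he).1 f (Finset.mem_sdiff.1 hf).1 hef v hve hvf
    · obtain ⟨i, hi, rfl⟩ := hAM f hf v hvf
      exact hpath e he i hi hve
    · obtain ⟨i, hi, rfl⟩ := hAM e he v hve
      exact hpath f hf i hi hvf
    · obtain ⟨a, ha, rfl⟩ := hAmem e he
      obtain ⟨b, hb, rfl⟩ := hAmem f hf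
      have hab : a ≠ b := fun h ↦ hef (h ▸ rfl)
      rcases Sym2.mem_iff.1 hve with rfl | rfl <;> rcases Sym2.mem_iff.1 hvf with h | h <;>
      · have := hinj _ (by omega) _ (by omega) h
        omega
  · rw [Finset.card_union_of_disjoint hdisj, hAcard]
    have := Finset.le_card_sdiff B M
    omega

/-- Each finite vertex set `S` carries a matching that admits no augmenting path inside `S`. -/
theorem exists_matching_forall_not_isAugPath {V : Type*} (G : SimpleGraph V) (S : Finset V) :
    ∃ M : Set (Sym2 V), IsGraphMatching G M ∧
      ∀ k p, (∀ i ≤ 2 * k + 1, p i ∈ S) → ¬ IsAugPath G M k p := by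
  classical
  obtain ⟨M, hM, hmax⟩ := Finset.exists_max_image
    (S.sym2.powerset.filter fun M : Finset (Sym2 V) ↦ IsGraphMatching G (M : Set (Sym2 V)))
    Finset.card
    ⟨∅, by simp [IsGraphMatching]⟩
  rw [Finset.mem_filter, Finset.mem_powerset] at hM
  refine ⟨M, hM.2, fun k p hpS hp ↦ ?_⟩
  obtain ⟨M', hM'S, hM', hlt⟩ := hp.exists_larger hM.2 hM.1 hpS
  exact hlt.not_ge (hmax M' (by simp [hM'S, hM']))

/-- A locally finite graph has a matching with no augmenting paths: take the limit, along an
ultrafilter on the finite vertex sets, of matchings of finite vertex sets. -/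
theorem exists_matching_of_finite_neighborSet {V : Type*} (G : SimpleGraph V)
    (hfin : ∀ v : V, (G.neighborSet v).Finite) :
    ∃ M : Set (Sym2 V), IsGraphMatching G M ∧ ∀ k p, ¬ IsAugPath G M k p := by
  classical
  choose N hN hNaug using exists_matching_forall_not_isAugPath G
  let U : Ultrafilter (Finset V) := Ultrafilter.of Filter.atTop
  have hU : (U : Filter (Finset V)) ≤ Filter.atTop := Ultrafilter.of_le _
  let M : Set (Sym2 V) := {e | ∀ᶠ S in (U : Filter (Finset V)), e ∈ N S}
  have hnot : ∀ e, e ∉ M → ∀ᶠ S in (U : Filter (Finset V)), e ∉ N S := fun e he ↦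
    Ultrafilter.eventually_not.2 he
  have hunm : ∀ v, v ∉ matchedSet M → ∀ᶠ S in (U : Filter (Finset V)), v ∉ matchedSet (N S) := by
    intro v hv
    have h : ∀ᶠ S in (U : Filter (Finset V)), ∀ w ∈ G.neighborSet v, s(v, w) ∉ N S :=
      (Filter.eventually_all_finite (hfin v)).2 fun w _ ↦
        hnot _ fun hw ↦ hv ⟨_, hw, Sym2.mem_mk_left v w⟩
    filter_upwards [h] with S hS
    rintro ⟨e, he, w, rfl⟩
    exact hS w ((hN S).1 he) he
  refine ⟨M, ⟨fun e he ↦ ?_, fun e he f hf hef ↦ ?_⟩, ?_⟩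
  · obtain ⟨S, hS⟩ := Filter.Eventually.exists he
    exact (hN S).1 hS
  · obtain ⟨S, hSe, hSf⟩ := (Filter.Eventually.and he hf).exists
    exact (hN S).2 e hSe f hSf hef
  · rintro k p ⟨hinj, hadj, hout, hin, h0, hend⟩
    have hout' : ∀ᶠ S in (U : Filter (Finset V)),
        ∀ j ∈ Set.Iic k, s(p (2 * j), p (2 * j + 1)) ∉ N S :=
      (Filter.eventually_all_finite (Set.finite_Iic k)).2 fun j hj ↦ hnot _ (hout j hj)
    have hin' : ∀ᶠ S in (U : Filter (Finset V)),
        ∀ j ∈ Set.Iio k, s(p (2 * j + 1), p (2 * j + 2)) ∈ N S :=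
      (Filter.eventually_all_finite (Set.finite_Iio k)).2 fun j hj ↦ hin j hj
    have hsub := hU (Filter.eventually_ge_atTop ((Finset.range (2 * k + 2)).image p))
    obtain ⟨S, hS1, hS2, hS3, hS4, hS5⟩ :=
      (hout'.and (hin'.and ((hunm _ h0).and ((hunm _ hend).and hsub)))).exists
    exact hNaug S k p
      (fun i hi ↦ hS5 (Finset.mem_image_of_mem p (Finset.mem_range.2 (by omega))))
      ⟨hinj, hadj, hS1, hS2, hS3, hS4⟩

/-- A countable connected graph with all degrees at most `d`
contains a matching with no `k`-augmenting paths for any `k ≤ T`. -/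
theorem stmt1 {V : Type*} [Countable V] (G : SimpleGraph V) (hconn : G.Connected)
    (d : ℕ) (hdeg : ∀ v : V, (G.neighborSet v).Finite ∧ (G.neighborSet v).ncard ≤ d)
    (T : ℕ) (hT : 0 < T) :
    ∃ M : Set (Sym2 V), IsGraphMatching G M ∧
      ∀ k ≤ T, ∀ p : ℕ → V, ¬ IsAugPath G M k p := by
  obtain ⟨M, hM, hMaug⟩ := exists_matching_of_finite_neighborSet G fun v ↦ (hdeg v).1
  exact ⟨M, hM, fun k _ p ↦ hMaug k p⟩
end

section
/- Let X be a standard Borel space and let G = (X, E) be a Borel graph in which every vertex has degree at most d, and let T be a positive integer. Then G contains a Borel matching M that has no k-augmenting paths for any k ≤ T. -/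
/-- `E` is a Borel graph relation on `X`: a Borel, symmetric, irreflexive subset
of `X × X`. -/
def IsBorelGraph {X : Type*} [MeasurableSpace X] (E : Set (X × X)) : Prop :=
  MeasurableSet E ∧ (∀ x y : X, (x, y) ∈ E → (y, x) ∈ E) ∧ ∀ x : X, (x, x) ∉ E

/-- `M` is a Borel matching of the Borel graph `E`: a Borel symmetric subset of `E`
in which every vertex lies in at most one (unordered) edge. -/
def IsBorelMatching {X : Type*} [MeasurableSpace X] (E M : Set (X × X)) : Prop :=
  M ⊆ E ∧ MeasurableSet M ∧ (∀ x y : X, (x, y) ∈ M → (y, x) ∈ M) ∧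
  ∀ x y z : X, (x, y) ∈ M → (x, z) ∈ M → y = z

/-- The set `X_M` of vertices matched by `M`. -/
def matchedSetB {X : Type*} (M : Set (X × X)) : Set X := {x | ∃ y : X, (x, y) ∈ M}

/-- `p 0, p 1, …, p (2k+1)` is a `k`-augmenting path for the matching `M` in the
graph `E`: the vertices are distinct, consecutive vertices are adjacent in `E`,
even-indexed edges are outside `M`, odd-indexed edges are in `M`, and both
endpoints are unmatched. -/
def IsAugPathB {X : Type*} (E M : Set (X × X)) (k : ℕ) (p : ℕ → X) : Prop :=
  (∀ i ≤ 2 * k + 1, ∀ j ≤ 2 * k + 1, p i = p j → i = j) ∧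
  (∀ i < 2 * k + 1, (p i, p (i + 1)) ∈ E) ∧
  (∀ j ≤ k, (p (2 * j), p (2 * j + 1)) ∉ M) ∧
  (∀ j < k, (p (2 * j + 1), p (2 * j + 2)) ∈ M) ∧
  p 0 ∉ matchedSetB M ∧ p (2 * k + 1) ∉ matchedSetB M

open Set

universe u

/-- The projection of a Borel set whose sections have uniformly bounded size is Borel. -/
theorem measurableSet_exists_of_encard_le {Y : Type u} [MeasurableSpace Y] [StandardBorelSpace Y]
    (d : ℕ) : ∀ {X : Type u} [MeasurableSpace X] [StandardBorelSpace X] (S : Set (X × Y)),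
      MeasurableSet S → (∀ x, {y | (x, y) ∈ S}.encard ≤ d) →
      MeasurableSet {x | ∃ y, (x, y) ∈ S} := by
  induction d with
  | zero =>
    intro X _ _ S _ hd
    have : {x | ∃ y, (x, y) ∈ S} = ∅ := by
      ext x
      have := hd x
      simp only [Nat.cast_zero, nonpos_iff_eq_zero, encard_eq_zero] at this
      simpa [Set.ext_iff] using this
    rw [this]
    exact MeasurableSet.empty
  | succ d ih =>
    intro X _ _ S hS hd
    let e : Y → ℝ := MeasureTheory.embeddingReal Y
    have he : MeasurableEmbedding e := MeasureTheory.measurableEmbedding_embeddingReal Y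
    -- points of `S` that are not the largest of their section
    let S' : Set ((X × Y) × Y) := {q | q.1 ∈ S ∧ (q.1.1, q.2) ∈ S ∧ e q.1.2 < e q.2}
    have hS' : MeasurableSet S' := by
      refine (measurable_fst hS).inter (MeasurableSet.inter ?_ ?_)
      · exact (Measurable.prodMk (measurable_fst.comp measurable_fst) measurable_snd) hS
      · exact measurableSet_lt (he.measurable.comp (measurable_snd.comp measurable_fst))
          (he.measurable.comp measurable_snd)
    have hproj := ih S' hS' (by
      rintro ⟨x, y⟩
      by_cases hy : (x, y) ∈ S
      · have h1 : insert y {z | ((x, y), z) ∈ S'} ⊆ {z | (x, z) ∈ S} := by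
          rintro z (rfl | hz)
          · exact hy
          · exact hz.2.1
        have h2 := (encard_le_encard h1).trans (hd x)
        rw [encard_insert_of_notMem (fun h => lt_irrefl _ h.2.2)] at h2
        push_cast at h2
        exact (ENat.add_le_add_iff_right ENat.one_ne_top).1 h2
      · have : {z | ((x, y), z) ∈ S'} = ∅ := by
          ext z
          exact iff_of_false (fun h => hy h.1) (notMem_empty _)
        rw [this]
        simp)
    have heq : {x | ∃ y, (x, y) ∈ S} = Prod.fst '' (S \ {q | ∃ z, (q, z) ∈ S'}) := by
      ext x
      constructor
      · intro hx
        obtain ⟨y, hy, hmax⟩ := exists_max_image {y | (x, y) ∈ S} e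
          (finite_of_encard_le_coe (hd x)) hx
        exact ⟨(x, y), ⟨hy, fun ⟨z, hz⟩ => (hmax z hz.2.1).not_gt hz.2.2⟩, rfl⟩
      · rintro ⟨⟨x, y⟩, h, rfl⟩
        exact ⟨y, h.1⟩
    rw [heq]
    refine (hS.diff hproj).image_of_measurable_injOn measurable_fst ?_
    rintro ⟨x, y⟩ ⟨hy, hy'⟩ ⟨_, z⟩ ⟨hz, hz'⟩ rfl
    have : e y = e z := le_antisymm
      (not_lt.1 fun h => hz' ⟨y, hz, hy, h⟩) (not_lt.1 fun h => hy' ⟨z, hy, hz, h⟩)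
    rw [he.injective this]

/-- A Borel relation of bounded degree admits a countable Borel cover by sets in which no two
distinct points are related. -/
theorem exists_measurable_cover_independent {X : Type*} [MeasurableSpace X]
    [StandardBorelSpace X] (R : Set (X × X)) (hR : MeasurableSet R) (d : ℕ)
    (hd : ∀ x, {y | (x, y) ∈ R}.encard ≤ d) :
    ∃ A : ℕ → Set X, (∀ n, MeasurableSet (A n)) ∧ (∀ x, ∃ n, x ∈ A n) ∧
      ∀ n, ∀ x ∈ A n, ∀ y ∈ A n, (x, y) ∈ R → x = y := by
  let := upgradeStandardBorel X
  have hb := TopologicalSpace.isBasis_countableBasis X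
  obtain ⟨U, hU⟩ := ((TopologicalSpace.countable_countableBasis X).insert ∅).exists_eq_range
    (insert_nonempty _ _)
  have hUo (n : ℕ) : IsOpen (U n) := by
    obtain h | h : U n ∈ insert ∅ (TopologicalSpace.countableBasis X) := hU ▸ mem_range_self n
    · exact h ▸ isOpen_empty
    · exact hb.isOpen h
  have hS (n : ℕ) : MeasurableSet {q : X × X | q ∈ R ∧ q.1 ≠ q.2 ∧ q.2 ∈ U n} :=
    hR.inter ((measurableSet_eq_fun measurable_fst measurable_snd).compl.inter
      (measurable_snd (hUo n).measurableSet))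
  refine ⟨fun n => U n \ {x | ∃ y, (x, y) ∈ {q : X × X | q ∈ R ∧ q.1 ≠ q.2 ∧ q.2 ∈ U n}},
    fun n => (hUo n).measurableSet.diff (measurableSet_exists_of_encard_le d _ (hS n)
      fun x => (encard_le_encard fun y hy => hy.1).trans (hd x)), fun x => ?_, ?_⟩
  · have hfin : ({y | (x, y) ∈ R} \ {x}).Finite := (finite_of_encard_le_coe (hd x)).sdiff
    obtain ⟨V, hV, hxV, hVs⟩ := hb.exists_subset_of_mem_open
      (show x ∈ ({y | (x, y) ∈ R} \ {x})ᶜ from fun h => h.2 rfl) hfin.isClosed.isOpen_compl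
    obtain ⟨n, rfl⟩ : V ∈ range U := hU ▸ mem_insert_of_mem _ hV
    exact ⟨n, hxV, fun ⟨y, hy, hne, hyU⟩ => hVs hyU ⟨hy, fun h => hne (Eq.symm h)⟩⟩
  · rintro n x ⟨-, hx⟩ y ⟨hy, -⟩ hxy
    by_contra hne
    exact hx ⟨y, hxy, hne, hy⟩

/-- The pairs of vertices at distance at most `n` in the graph `E`. -/
def withinDist {X : Type*} (E : Set (X × X)) : ℕ → Set (X × X)
  | 0 => {q | q.1 = q.2}
  | n + 1 => {q | ∃ y, (q.1, y) ∈ withinDist E n ∧ (y = q.2 ∨ (y, q.2) ∈ E)}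

section withinDist

variable {X : Type*} {E : Set (X × X)}

theorem withinDist_mono {m n : ℕ} (h : m ≤ n) : withinDist E m ⊆ withinDist E n := by
  induction h with
  | refl => exact subset_rfl
  | step _ ih => exact ih.trans fun q hq => ⟨q.2, hq, Or.inl rfl⟩

theorem withinDist_trans {m n : ℕ} {x y z : X} (hxy : (x, y) ∈ withinDist E m)
    (hyz : (y, z) ∈ withinDist E n) : (x, z) ∈ withinDist E (m + n) := by
  induction n generalizing z with
  | zero =>
    obtain rfl : y = z := hyz
    exact hxy
  | succ n ih =>
    obtain ⟨w, hw, hwz⟩ := hyz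
    exact ⟨w, ih hw, hwz⟩

theorem withinDist_symm (hE : ∀ x y, (x, y) ∈ E → (y, x) ∈ E) {n : ℕ} {x y : X}
    (h : (x, y) ∈ withinDist E n) : (y, x) ∈ withinDist E n := by
  induction n generalizing y with
  | zero => exact Eq.symm h
  | succ n ih =>
    obtain ⟨w, hw, hwy⟩ := h
    have h1 : (y, w) ∈ withinDist E 1 := ⟨y, rfl, hwy.imp Eq.symm (hE _ _)⟩
    exact add_comm 1 n ▸ withinDist_trans h1 (ih hw)

theorem withinDist_of_path (hE : ∀ x y, (x, y) ∈ E → (y, x) ∈ E) {n : ℕ} {p : ℕ → X}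
    (hp : ∀ i < n, (p i, p (i + 1)) ∈ E) {i j : ℕ} (hi : i ≤ n) (hj : j ≤ n) :
    (p i, p j) ∈ withinDist E n := by
  have key : ∀ m i, i + m ≤ n → (p i, p (i + m)) ∈ withinDist E m := by
    intro m
    induction m with
    | zero => exact fun _ _ => rfl
    | succ m ih => exact fun i hi => ⟨p (i + m), ih i (by omega), Or.inr (hp _ (by omega))⟩
  rcases le_total i j with h | h
  · obtain ⟨m, rfl⟩ := Nat.exists_eq_add_of_le h
    exact withinDist_mono (by omega) (key m i hj)
  · obtain ⟨m, rfl⟩ := Nat.exists_eq_add_of_le h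
    exact withinDist_symm hE (withinDist_mono (by omega) (key m j hi))

theorem encard_withinDist_le {d : ℕ} (hd : ∀ x, {y | (x, y) ∈ E}.encard ≤ d) (n : ℕ) (x : X) :
    {y | (x, y) ∈ withinDist E n}.encard ≤ ((d + 1) ^ n : ℕ) := by
  induction n with
  | zero =>
    have : {y | (x, y) ∈ withinDist E 0} = {x} := by
      ext y
      exact eq_comm
    simp [this]
  | succ n ih =>
    have hfin := finite_of_encard_le_coe ih
    have hsub : {y | (x, y) ∈ withinDist E (n + 1)} ⊆
        ⋃ w ∈ hfin.toFinset, insert w {y | (w, y) ∈ E} := by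
      rintro y ⟨w, hw, hwy⟩
      exact mem_biUnion (by simpa using hw) (hwy.imp Eq.symm id)
    have hw (w : X) : (insert w {y | (w, y) ∈ E}).encard ≤ (d + 1 : ℕ) := by
      push_cast
      exact (encard_insert_le _ _).trans (by gcongr; exact hd w)
    have hcard : hfin.toFinset.card ≤ (d + 1) ^ n := by
      rw [hfin.encard_eq_coe_toFinset_card] at ih
      exact_mod_cast ih
    calc {y | (x, y) ∈ withinDist E (n + 1)}.encard
        ≤ (⋃ w ∈ hfin.toFinset, insert w {y | (w, y) ∈ E}).encard := encard_le_encard hsub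
      _ ≤ ∑ w ∈ hfin.toFinset, (insert w {y | (w, y) ∈ E}).encard :=
          Finset.set_encard_biUnion_le _ _
      _ ≤ ∑ _w ∈ hfin.toFinset, ((d + 1 : ℕ) : ℕ∞) := Finset.sum_le_sum fun w _ => hw w
      _ = ((hfin.toFinset.card * (d + 1) : ℕ) : ℕ∞) := by simp [mul_add]
      _ ≤ ((d + 1) ^ (n + 1) : ℕ) := by
          rw [pow_succ]
          exact_mod_cast Nat.mul_le_mul_right _ hcard

theorem measurableSet_withinDist [MeasurableSpace X] [StandardBorelSpace X]
    (hE : MeasurableSet E) {d : ℕ} (hd : ∀ x, {y | (x, y) ∈ E}.encard ≤ d) (n : ℕ) :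
    MeasurableSet (withinDist E n) := by
  induction n with
  | zero => exact measurableSet_eq_fun measurable_fst measurable_snd
  | succ n ih =>
    refine measurableSet_exists_of_encard_le ((d + 1) ^ n)
      {q : (X × X) × X | (q.1.1, q.2) ∈ withinDist E n ∧ (q.2 = q.1.2 ∨ (q.2, q.1.2) ∈ E)} ?_
      fun q => (encard_le_encard fun y hy => hy.1).trans (encard_withinDist_le hd n q.1)
    refine MeasurableSet.inter ?_ (MeasurableSet.union ?_ ?_)
    · exact (Measurable.prodMk (measurable_fst.comp measurable_fst) measurable_snd) ih
    · exact measurableSet_eq_fun measurable_snd (measurable_snd.comp measurable_fst)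
    · exact (Measurable.prodMk measurable_snd (measurable_snd.comp measurable_fst)) hE

end withinDist

/-- The `k`-augmenting paths `p` for `M` whose `i`-th vertex lies in `A (t i)`, normalized to be
constant from the last vertex on. -/
def augPathsOfType {X : Type*} (E : Set (X × X)) (A : ℕ → Set X) (k : ℕ) (t : List ℕ)
    (M : Set (X × X)) : Set (ℕ → X) :=
  {p | IsAugPathB E M k p ∧ (∀ i ≤ 2 * k + 1, p i ∈ A (t.getD i 0)) ∧
    ∀ i, 2 * k + 1 ≤ i → p i = p (2 * k + 1)}

/-- The vertices `p 0, …, p (2 * k + 1)` of the paths in `P`. -/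
def pathVertices {X : Type*} (k : ℕ) (P : Set (ℕ → X)) : Set X :=
  ⋃ i ≤ 2 * k + 1, (fun p => p i) '' P

/-- The even-indexed edges of the paths in `P`, in both orientations. -/
def evenEdges {X : Type*} (k : ℕ) (P : Set (ℕ → X)) : Set (X × X) :=
  ⋃ j ≤ k, ((fun p => (p (2 * j), p (2 * j + 1))) '' P ∪
    (fun p => (p (2 * j + 1), p (2 * j))) '' P)

/-- The matching obtained from `M` by flipping all paths in `P`. -/
def flipPaths {X : Type*} (k : ℕ) (P : Set (ℕ → X)) (M : Set (X × X)) : Set (X × X) :=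
  {q | q ∈ M ∧ q.1 ∉ pathVertices k P} ∪ evenEdges k P

section flip

variable {X : Type*} {E M : Set (X × X)} {k : ℕ} {P : Set (ℕ → X)}

theorem mem_pathVertices {x : X} :
    x ∈ pathVertices k P ↔ ∃ i ≤ 2 * k + 1, ∃ p ∈ P, p i = x := by
  simp [pathVertices]

theorem mem_evenEdges {x y : X} : (x, y) ∈ evenEdges k P ↔ ∃ j ≤ k, ∃ p ∈ P,
    (p (2 * j) = x ∧ p (2 * j + 1) = y) ∨ (p (2 * j + 1) = x ∧ p (2 * j) = y) := by
  simp only [evenEdges, mem_iUnion, mem_union, mem_image, Prod.mk.injEq, exists_prop, ← exists_or,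
    ← and_or_left]

theorem fst_mem_pathVertices_of_mem_evenEdges {x y : X} (h : (x, y) ∈ evenEdges k P) :
    x ∈ pathVertices k P := by
  obtain ⟨j, hj, p, hp, ⟨h, -⟩ | ⟨h, -⟩⟩ := mem_evenEdges.1 h
  · exact mem_pathVertices.2 ⟨2 * j, by omega, p, hp, h⟩
  · exact mem_pathVertices.2 ⟨2 * j + 1, by omega, p, hp, h⟩

theorem evenEdges_symm {x y : X} (h : (x, y) ∈ evenEdges k P) : (y, x) ∈ evenEdges k P := by
  obtain ⟨j, hj, p, hp, h⟩ := mem_evenEdges.1 h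
  exact mem_evenEdges.2 ⟨j, hj, p, hp, h.symm.imp And.symm And.symm⟩

theorem exists_mem_evenEdges {x : X} (h : x ∈ pathVertices k P) :
    ∃ y, (x, y) ∈ evenEdges k P := by
  obtain ⟨i, hi, p, hp, rfl⟩ := mem_pathVertices.1 h
  obtain ⟨j, rfl | rfl⟩ := Nat.even_or_odd' i
  · exact ⟨p (2 * j + 1), mem_evenEdges.2 ⟨j, by omega, p, hp, Or.inl ⟨rfl, rfl⟩⟩⟩
  · exact ⟨p (2 * j), mem_evenEdges.2 ⟨j, by omega, p, hp, Or.inr ⟨rfl, rfl⟩⟩⟩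

theorem mem_flipPaths_of_notMem {x y : X} (hx : x ∉ pathVertices k P) :
    (x, y) ∈ flipPaths k P M ↔ (x, y) ∈ M :=
  ⟨fun h => h.elim And.left fun h => absurd (fst_mem_pathVertices_of_mem_evenEdges h) hx,
    fun h => Or.inl ⟨h, hx⟩⟩

theorem matchedSetB_flipPaths :
    matchedSetB (flipPaths k P M) = matchedSetB M ∪ pathVertices k P := by
  ext x
  by_cases hx : x ∈ pathVertices k P
  · obtain ⟨y, hy⟩ := exists_mem_evenEdges hx
    exact iff_of_true ⟨y, Or.inr hy⟩ (Or.inr hx)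
  · simp [matchedSetB, mem_flipPaths_of_notMem hx, hx]

variable [MeasurableSpace X]

/-- A matching edge that meets an augmenting path stays on the path. -/
theorem IsAugPathB.mate_mem (hM : IsBorelMatching E M) {p : ℕ → X} (hp : IsAugPathB E M k p)
    {i : ℕ} (hi : i ≤ 2 * k + 1) {y : X} (h : (p i, y) ∈ M) : ∃ j ≤ 2 * k + 1, p j = y := by
  obtain ⟨-, -, -, hodd, h0, h1⟩ := hp
  obtain ⟨j, rfl | rfl⟩ := Nat.even_or_odd' i
  · obtain _ | j := j
    · exact absurd ⟨y, h⟩ h0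
    · exact ⟨2 * j + 1, by omega, hM.2.2.2 _ _ _ (hM.2.2.1 _ _ (hodd j (by omega))) h⟩
  · obtain rfl | hj := (show j ≤ k by omega).eq_or_lt
    · exact absurd ⟨y, h⟩ h1
    · exact ⟨2 * j + 2, by omega, hM.2.2.2 _ _ _ (hodd j hj) h⟩

variable [StandardBorelSpace X]

theorem measurableSet_matchedSetB (hM : IsBorelMatching E M) : MeasurableSet (matchedSetB M) := by
  have : matchedSetB M = Prod.fst '' M := by
    ext x
    simp [matchedSetB]
  rw [this]
  refine hM.2.1.image_of_measurable_injOn measurable_fst ?_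
  rintro ⟨x, y⟩ hy ⟨_, z⟩ hz rfl
  rw [hM.2.2.2 _ _ _ hy hz]

theorem measurableSet_augPathsOfType (hE : MeasurableSet E) (hM : IsBorelMatching E M)
    {A : ℕ → Set X} (hA : ∀ n, MeasurableSet (A n)) (t : List ℕ) :
    MeasurableSet (augPathsOfType E A k t M) := by
  have hm := measurableSet_matchedSetB hM
  have hev (i : ℕ) : Measurable fun p : ℕ → X => p i := measurable_pi_apply i
  have heq (i j : ℕ) : Measurable fun p : ℕ → X => p i = p j :=
    measurableSet_setOfPred.1 (measurableSet_eq_fun (hev i) (hev j))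
  have hpr (i j : ℕ) {S : Set (X × X)} (hS : MeasurableSet S) :
      Measurable fun p : ℕ → X => (p i, p j) ∈ S :=
    measurableSet_setOfPred.1 (((hev i).prodMk (hev j)) hS)
  have hmem (i : ℕ) {S : Set X} (hS : MeasurableSet S) : Measurable fun p : ℕ → X => p i ∈ S :=
    measurableSet_setOfPred.1 (hev i hS)
  unfold augPathsOfType IsAugPathB
  refine measurableSet_setOfPred.2 (.and (.and ?_ (.and ?_ (.and ?_ (.and ?_ (.and ?_ ?_)))))
    (.and ?_ ?_))
  · exact .forall fun i => .forall fun _ => .forall fun j => .forall fun _ =>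
      (heq i j).imp measurable_const
  · exact .forall fun i => .forall fun _ => hpr _ _ hE
  · exact .forall fun i => .forall fun _ => (hpr _ _ hM.2.1).not
  · exact .forall fun i => .forall fun _ => hpr _ _ hM.2.1
  · exact (hmem 0 hm).not
  · exact (hmem _ hm).not
  · exact .forall fun i => .forall fun _ => hmem _ (hA _)
  · exact .forall fun i => .forall fun _ => heq _ _

/-- Flipping a Borel family of pairwise disjoint augmenting paths yields a Borel matching. -/
theorem IsBorelMatching.flipPaths (hE : ∀ x y, (x, y) ∈ E → (y, x) ∈ E)
    (hM : IsBorelMatching E M) (hP : MeasurableSet P) (haug : ∀ p ∈ P, IsAugPathB E M k p)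
    (hdisj : ∀ p ∈ P, ∀ q ∈ P, ∀ i ≤ 2 * k + 1, ∀ j ≤ 2 * k + 1, p i = q j → p = q) :
    IsBorelMatching E (flipPaths k P M) := by
  have hinj {i : ℕ} (hi : i ≤ 2 * k + 1) : InjOn (fun p : ℕ → X => p i) P :=
    fun p hp q hq h => hdisj p hp q hq i hi i hi h
  have hev (i : ℕ) : Measurable fun p : ℕ → X => p i := measurable_pi_apply i
  have hV : MeasurableSet (pathVertices k P) :=
    .iUnion fun i => .iUnion fun hi => hP.image_of_measurable_injOn (hev i) (hinj hi)
  have hF : MeasurableSet (evenEdges k P) := by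
    refine .iUnion fun j => .iUnion fun hj => .union ?_ ?_
    · exact hP.image_of_measurable_injOn ((hev _).prodMk (hev _)) fun p hp q hq h =>
        hinj (i := 2 * j) (by omega) hp hq (Prod.ext_iff.1 h).1
    · exact hP.image_of_measurable_injOn ((hev _).prodMk (hev _)) fun p hp q hq h =>
        hinj (i := 2 * j) (by omega) hp hq (Prod.ext_iff.1 h).2
  refine ⟨?_, (hM.2.1.inter (measurable_fst hV.compl)).union hF, ?_, ?_⟩
  · rintro ⟨x, y⟩ (h | h)
    · exact hM.1 h.1
    · obtain ⟨j, hj, p, hp, ⟨rfl, rfl⟩ | ⟨rfl, rfl⟩⟩ := mem_evenEdges.1 h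
      · exact (haug p hp).2.1 _ (by omega)
      · exact hE _ _ ((haug p hp).2.1 _ (by omega))
  · rintro x y (⟨h, hx⟩ | h)
    · refine Or.inl ⟨hM.2.2.1 _ _ h, fun hy => hx ?_⟩
      obtain ⟨i, hi, p, hp, rfl⟩ := mem_pathVertices.1 hy
      obtain ⟨j, hj, rfl⟩ := (haug p hp).mate_mem hM hi (hM.2.2.1 _ _ h)
      exact mem_pathVertices.2 ⟨j, hj, p, hp, rfl⟩
    · exact Or.inr (evenEdges_symm h)
  · rintro x y z (⟨hy, hx⟩ | hy) (⟨hz, hx'⟩ | hz)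
    · exact hM.2.2.2 _ _ _ hy hz
    · exact absurd (fst_mem_pathVertices_of_mem_evenEdges hz) hx
    · exact absurd (fst_mem_pathVertices_of_mem_evenEdges hy) hx'
    · obtain ⟨i, hi, p, hp, h⟩ := mem_evenEdges.1 hy
      obtain ⟨j, hj, q, hq, h'⟩ := mem_evenEdges.1 hz
      rcases h with ⟨h, rfl⟩ | ⟨h, rfl⟩ <;> rcases h' with ⟨h', rfl⟩ | ⟨h', rfl⟩ <;>
      · have hpq := h.trans h'.symm
        obtain rfl := hdisj p hp q hq _ (by omega) _ (by omega) hpq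
        have := (haug p hp).1 _ (by omega) _ (by omega) hpq
        first | omega | (obtain rfl : i = j := by omega); rfl

end flip

/-- Augmenting paths of the same type are disjoint when the sets `A n` contain no two distinct
points that are close to each other. -/
theorem augPathsOfType_disjoint {X : Type*} {E M : Set (X × X)} {A : ℕ → Set X} {k T : ℕ}
    {t : List ℕ} (hE : ∀ x y, (x, y) ∈ E → (y, x) ∈ E) (hk : k ≤ T)
    (hA : ∀ n, ∀ x ∈ A n, ∀ y ∈ A n,
      (x, y) ∈ withinDist E (2 * T + 1 + (2 * T + 1)) → x = y)
    {p q : ℕ → X} (hp : p ∈ augPathsOfType E A k t M) (hq : q ∈ augPathsOfType E A k t M)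
    {i j : ℕ} (hi : i ≤ 2 * k + 1) (hj : j ≤ 2 * k + 1) (h : p i = q j) : p = q := by
  obtain ⟨hpa, hpt, hpn⟩ := hp
  obtain ⟨hqa, hqt, hqn⟩ := hq
  have hpd {i j : ℕ} (hi : i ≤ 2 * k + 1) (hj : j ≤ 2 * k + 1) :
      (p i, p j) ∈ withinDist E (2 * T + 1) :=
    withinDist_mono (by omega) (withinDist_of_path hE hpa.2.1 hi hj)
  have hqd {i j : ℕ} (hi : i ≤ 2 * k + 1) (hj : j ≤ 2 * k + 1) :
      (q i, q j) ∈ withinDist E (2 * T + 1) :=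
    withinDist_mono (by omega) (withinDist_of_path hE hqa.2.1 hi hj)
  have key (l : ℕ) (hl : l ≤ 2 * k + 1) : p l = q l :=
    hA _ _ (hpt l hl) _ (hqt l hl) (withinDist_trans (hpd hl hi) (h ▸ hqd hj hl))
  funext l
  rcases le_total l (2 * k + 1) with hl | hl
  · exact key l hl
  · rw [hpn l hl, hqn l hl, key _ le_rfl]

/-- Any Borel graph of degree at most `d` on a standard Borel
space contains a Borel matching with no `k`-augmenting paths for any `k ≤ T`. -/
theorem stmt2 {X : Type*} [MeasurableSpace X] [StandardBorelSpace X]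
    (E : Set (X × X)) (hE : IsBorelGraph E) (d : ℕ)
    (hdeg : ∀ x : X, ({y : X | (x, y) ∈ E}).Finite ∧ ({y : X | (x, y) ∈ E}).ncard ≤ d)
    (T : ℕ) (hT : 0 < T) :
    ∃ M : Set (X × X), IsBorelMatching E M ∧
      ∀ k ≤ T, ∀ p : ℕ → X, ¬ IsAugPathB E M k p := by
  obtain ⟨hEm, hEs, -⟩ := hE
  have hd (x : X) : {y | (x, y) ∈ E}.encard ≤ d := by
    rw [← (hdeg x).1.cast_ncard_eq]
    exact_mod_cast (hdeg x).2
  obtain ⟨A, hAm, hAc, hA⟩ := exists_measurable_cover_independent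
    (withinDist E (2 * T + 1 + (2 * T + 1))) (measurableSet_withinDist hEm hd _) _
    (encard_withinDist_le hd _)
  -- a sequence of path types in which each type occurs infinitely often
  obtain ⟨g, hg⟩ := exists_surjective_nat (Fin (T + 1) × List ℕ)
  let K (n : ℕ) : ℕ := (g n.unpair.1).1
  let τ (n : ℕ) : List ℕ := (g n.unpair.1).2
  have hK (n : ℕ) : K n ≤ T := Nat.lt_succ_iff.1 (g n.unpair.1).1.2
  let M : ℕ → Set (X × X) := fun n => Nat.rec ∅
    (fun n N => flipPaths (K n) (augPathsOfType E A (K n) (τ n) N) N) n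
  let P (n : ℕ) : Set (ℕ → X) := augPathsOfType E A (K n) (τ n) (M n)
  have hsucc (n : ℕ) : M (n + 1) = flipPaths (K n) (P n) (M n) := rfl
  have hM (n : ℕ) : IsBorelMatching E (M n) := by
    induction n with
    | zero => exact ⟨empty_subset _, .empty, fun _ _ h => h.elim, fun _ _ _ h => h.elim⟩
    | succ n ih =>
      exact ih.flipPaths hEs (measurableSet_augPathsOfType hEm ih hAm _) (fun p hp => hp.1)
        fun p hp q hq i hi j hj h => augPathsOfType_disjoint hEs (hK n) hA hp hq hi hj h
  have hmono : Monotone fun n => matchedSetB (M n) := monotone_nat_of_le_succ fun n => by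
    rw [hsucc, matchedSetB_flipPaths]
    exact subset_union_left
  -- every vertex lies on only finitely many flipped paths
  have hstab (x : X) : ∃ N, ∀ n ≥ N, x ∉ pathVertices (K n) (P n) := by
    have hfin : {n | x ∈ pathVertices (K n) (P n)}.Finite := by
      refine ((finite_of_encard_le_coe (encard_withinDist_le hd (2 * T + 1) x)).biUnion
        (t := fun z => {n | ∃ p ∈ P n, p 0 = z}) fun z _ => Subsingleton.finite ?_).subset ?_
      · have key {m n : ℕ} {p q : ℕ → X} (hp : p ∈ P m) (hq : q ∈ P n) (h : p 0 = q 0) :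
            n ≤ m := by
          by_contra! hlt
          refine hq.1.2.2.2.2.1 (hmono (Nat.succ_le_of_lt hlt) ?_)
          dsimp only
          rw [Nat.succ_eq_add_one, hsucc, matchedSetB_flipPaths]
          exact Or.inr (mem_pathVertices.2 ⟨0, Nat.zero_le _, p, hp, h⟩)
        rintro m ⟨p, hp, rfl⟩ n ⟨q, hq, h⟩
        exact le_antisymm (key hq hp h) (key hp hq h.symm)
      · intro n hn
        obtain ⟨i, hi, p, hp, rfl⟩ := mem_pathVertices.1 hn
        refine mem_biUnion (x := p 0) ?_ ⟨p, hp, rfl⟩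
        exact withinDist_mono (by have := hK n; omega)
          (withinDist_of_path hEs hp.1.2.1 hi (Nat.zero_le _))
    obtain ⟨N, hN⟩ := hfin.bddAbove
    exact ⟨N + 1, fun n hn h => absurd (hN h) (by omega)⟩
  let L : Set (X × X) := ⋃ N, ⋂ n ≥ N, M n
  have hL {q : X × X} : q ∈ L ↔ ∃ N, ∀ n ≥ N, q ∈ M n := by simp [L]
  have hLM {x : X} {N : ℕ} (hN : ∀ n ≥ N, x ∉ pathVertices (K n) (P n)) {n : ℕ} (hn : N ≤ n)
      (y : X) : (x, y) ∈ M n ↔ (x, y) ∈ L := by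
    have h {n : ℕ} (hn : N ≤ n) : (x, y) ∈ M n ↔ (x, y) ∈ M N := by
      induction n, hn using Nat.le_induction with
      | base => rfl
      | succ n hn ih => rw [hsucc, mem_flipPaths_of_notMem (hN n hn), ih]
    rw [hL]
    refine ⟨fun hy => ⟨n, fun m hm => (h (hn.trans hm)).2 ((h hn).1 hy)⟩, fun ⟨m, hm⟩ => ?_⟩
    exact (h hn).2 ((h (le_max_left N m)).1 (hm _ (le_max_right N m)))
  refine ⟨L, ⟨?_, .iUnion fun N => .iInter fun n => .iInter fun _ => (hM n).2.1, ?_, ?_⟩, ?_⟩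
  · intro q hq
    obtain ⟨N, hN⟩ := hL.1 hq
    exact (hM N).1 (hN N le_rfl)
  · intro x y hxy
    obtain ⟨N, hN⟩ := hL.1 hxy
    exact hL.2 ⟨N, fun n hn => (hM n).2.2.1 _ _ (hN n hn)⟩
  · intro x y z hy hz
    obtain ⟨N, hN⟩ := hstab x
    exact (hM N).2.2.2 x y z ((hLM hN le_rfl y).2 hy) ((hLM hN le_rfl z).2 hz)
  · intro k hk p hp
    choose N hN using hstab
    choose c hc using hAc
    let N' := (Finset.range (2 * k + 2)).sup fun i => N (p i)
    obtain ⟨a, ha⟩ := hg (⟨k, Nat.lt_succ_of_le hk⟩, (List.range (2 * k + 2)).map fun i => c (p i))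
    let n := Nat.pair a N'
    have hKn : K n = k := by simp [K, n, ha]
    have hτn : τ n = (List.range (2 * k + 2)).map fun i => c (p i) := by simp [τ, n, ha]
    have hn {i : ℕ} (hi : i ≤ 2 * k + 1) : N (p i) ≤ n :=
      (Finset.le_sup (f := fun i => N (p i)) (Finset.mem_range.2 (by omega))).trans
        (Nat.right_le_pair a N')
    have hiff {i : ℕ} (hi : i ≤ 2 * k + 1) (y : X) : (p i, y) ∈ M n ↔ (p i, y) ∈ L :=
      hLM (hN (p i)) (hn hi) y
    let r (i : ℕ) : X := p (min i (2 * k + 1))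
    have hr {i : ℕ} (hi : i ≤ 2 * k + 1) : r i = p i := by simp [r, hi]
    have hrP : r ∈ P n := by
      change r ∈ augPathsOfType E A (K n) (τ n) (M n)
      rw [hKn]
      obtain ⟨h1, h2, h3, h4, h5, h6⟩ := hp
      refine ⟨⟨?_, ?_, ?_, ?_, ?_, ?_⟩, ?_, ?_⟩
      · intro i hi j hj h
        rw [hr hi, hr hj] at h
        exact h1 i hi j hj h
      · intro i hi
        rw [hr hi.le, hr hi]
        exact h2 i hi
      · intro j hj
        rw [hr (by omega), hr (by omega), hiff (by omega)]
        exact h3 j hj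
      · intro j hj
        rw [hr (by omega), hr (by omega), hiff (by omega)]
        exact h4 j hj
      · rw [hr (by omega)]
        exact fun ⟨y, hy⟩ => h5 ⟨y, (hiff (by omega) y).1 hy⟩
      · rw [hr le_rfl]
        exact fun ⟨y, hy⟩ => h6 ⟨y, (hiff le_rfl y).1 hy⟩
      · intro i hi
        have hi' : i < 2 * k + 2 := by omega
        have : (τ n).getD i 0 = c (p i) := by
          simp [hτn, List.getD_eq_getElem?_getD, hi']
        rw [this, hr hi]
        exact hc (p i)
      · intro i hi
        simp [r, hi]
    refine hN (p 0) n (hn (Nat.zero_le _)) (mem_pathVertices.2 ⟨0, Nat.zero_le _, r, hrP, ?_⟩)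
    exact hr (Nat.zero_le _)
end

section
/- There exists a Borel graph G = (X, E) on a standard Borel space X in which every vertex has degree exactly 2, such that every Borel matching of G admits a k-augmenting path for some finite k ≥ 0. -/
open MeasureTheory Set

/-- The graph of the translation by `a`: every `x` is joined to `x + a` and `x - a`. -/
def translationGraph {G : Type*} [AddCommGroup G] (a : G) : Set (G × G) :=
  {z | z.2 = z.1 + a ∨ z.1 = z.2 + a}

theorem neighborSet_translationGraph {G : Type*} [AddCommGroup G] (a x : G) :
    {y : G | (x, y) ∈ translationGraph a} = {x + a, x - a} := by
  ext y
  simp [translationGraph, eq_sub_iff_add_eq, eq_comm]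

theorem add_add_self_ne_of_injective_nsmul {G : Type*} [AddCommGroup G] {a : G}
    (ha : Function.Injective fun n : ℕ => n • a) (x : G) : x + a + a ≠ x := by
  intro h
  have h2 : a + a = 0 := by simpa [add_assoc] using h
  have := @ha 2 0 (by simpa [two_nsmul] using h2)
  omega

theorem isBorelGraph_translationGraph {G : Type*} [AddCommGroup G] [MeasurableSpace G]
    [MeasurableAdd G] [MeasurableEq G] {a : G} (ha : a ≠ 0) :
    IsBorelGraph (translationGraph a) := by
  refine ⟨?_, fun x y h => Or.symm h, fun x h => by simp [translationGraph, ha] at h⟩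
  exact (measurableSet_eq_fun measurable_snd (measurable_fst.add_const a)).union
    (measurableSet_eq_fun measurable_fst (measurable_snd.add_const a))

section Matching

variable {G : Type*} [AddCommGroup G] [MeasurableSpace G] {a : G} {M : Set (G × G)}

theorem IsBorelMatching.add_notMem_of_mem (hM : IsBorelMatching (translationGraph a) M)
    (ha : Function.Injective fun n : ℕ => n • a) {x : G} (hx : (x, x + a) ∈ M) :
    (x + a, x + a + a) ∉ M := fun h =>
  add_add_self_ne_of_injective_nsmul ha x (hM.2.2.2 _ _ _ h (hM.2.2.1 _ _ hx))

/-- A vertex is matched iff it is matched to its successor or to its predecessor. -/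
theorem IsBorelMatching.add_mem_matchedSetB_iff (hM : IsBorelMatching (translationGraph a) M)
    (x : G) :
    x + a ∈ matchedSetB M ↔ (x, x + a) ∈ M ∨ (x + a, x + a + a) ∈ M := by
  constructor
  · rintro ⟨y, hy⟩
    rcases hM.1 hy with h | h
    · right; simp only at h; rwa [← h]
    · left
      obtain rfl : x = y := add_right_cancel h
      exact hM.2.2.1 _ _ hy
  · rintro (h | h)
    · exact ⟨x, hM.2.2.1 _ _ h⟩
    · exact ⟨_, h⟩

/-- Two unmatched vertices on one orbit, with only matched vertices in between, are the ends of an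
augmenting path. -/
theorem IsBorelMatching.exists_isAugPathB (hM : IsBorelMatching (translationGraph a) M)
    (ha : Function.Injective fun n : ℕ => n • a) {x : G} (hx : x ∉ matchedSetB M)
    (hn : ∃ n : ℕ, n ≠ 0 ∧ x + n • a ∉ matchedSetB M) :
    ∃ (k : ℕ) (p : ℕ → G), IsAugPathB (translationGraph a) M k p := by
  classical
  have hmin := fun m => @Nat.find_min _ _ hn m
  obtain ⟨hn0, hnU⟩ := Nat.find_spec hn
  set n := Nat.find hn
  have hstep (i : ℕ) : x + (i + 1) • a = x + i • a + a := by rw [succ_nsmul, add_assoc]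
  have hpar (i : ℕ) (hi : i < n) :
      (x + i • a, x + (i + 1) • a) ∈ M ↔ i % 2 = 1 := by
    induction i with
    | zero =>
      simp only [Nat.zero_mod, zero_ne_one, iff_false, zero_smul, add_zero]
      exact fun h => hx ⟨_, h⟩
    | succ i ih =>
      have ih := ih (by omega)
      have hm : x + (i + 1) • a ∈ matchedSetB M := by
        by_contra h
        exact hmin (i + 1) hi ⟨by omega, h⟩
      rw [hstep i, hM.add_mem_matchedSetB_iff] at hm
      rw [hstep i] at ih
      rw [hstep (i + 1), hstep i]
      have hne := fun h => hM.add_notMem_of_mem ha (x := x + i • a) h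
      have : (i + 1) % 2 = 1 ↔ ¬ i % 2 = 1 := by omega
      rw [this, ← ih]
      tauto
  have hlast : ¬ (n - 1) % 2 = 1 := by
    rw [← hpar (n - 1) (by omega), Nat.sub_add_cancel (by omega)]
    exact fun h => hnU ⟨_, hM.2.2.1 _ _ h⟩
  have hnk : n = 2 * ((n - 1) / 2) + 1 := by omega
  refine ⟨(n - 1) / 2, fun i => x + i • a, ?_, ?_, ?_, ?_, ?_, ?_⟩
  · exact fun i _ j _ h => ha (add_left_cancel h)
  · exact fun i _ => Or.inl (hstep i)
  · intro j hj
    rw [hpar _ (by omega)]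
    omega
  · intro j hj
    rw [hpar _ (by omega)]
    omega
  · simpa using hx
  · rwa [← hnk]

/-- If translation by `a` is measure preserving and translation by `a + a` is ergodic, then every
Borel matching of the graph of translation by `a` leaves two vertices of some orbit unmatched. -/
theorem IsBorelMatching.exists_notMem_matchedSetB [MeasurableAdd G] {μ : Measure G}
    [IsFiniteMeasure μ] [NeZero μ] (hM : IsBorelMatching (translationGraph a) M)
    (ha : Function.Injective fun n : ℕ => n • a)
    (hpres : MeasurePreserving (· + a) μ μ) (herg : Ergodic (· + (a + a)) μ) :
    ∃ x ∉ matchedSetB M, ∃ n : ℕ, n ≠ 0 ∧ x + n • a ∉ matchedSetB M := by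
  by_contra! hcon
  set A : Set G := {x | (x, x + a) ∈ M}
  have hA : MeasurableSet A := (measurable_id.prodMk (measurable_id.add_const a)) hM.2.1
  set U : Set G := (matchedSetB M)ᶜ
  have hUpre : (· + a) ⁻¹' U = Aᶜ ∩ ((· + a) ⁻¹' A)ᶜ := by
    ext x
    simp only [U, A, mem_preimage, mem_compl_iff, hM.add_mem_matchedSetB_iff, mem_inter_iff,
      mem_ofPred_eq, not_or]
  have hVmeas : MeasurableSet ((· + a) ⁻¹' U) := by
    rw [hUpre]
    exact hA.compl.inter (hpres.measurable hA).compl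
  have hV : μ ((· + a) ⁻¹' U) = 0 := by
    by_contra h0
    obtain ⟨x, hx, m, hm, hxm⟩ :=
      hpres.conservative.exists_mem_iterate_mem hVmeas.nullMeasurableSet h0
    rw [add_right_iterate] at hxm
    refine absurd (hcon (x + a) hx m hm) ?_
    rw [add_right_comm]
    exact hxm
  have hcompl : (· + a) ⁻¹' A =ᵐ[μ] (Aᶜ : Set G) := by
    have hae : ∀ᵐ x ∂μ, x ∉ (· + a) ⁻¹' U := measure_eq_zero_iff_ae_notMem.1 hV
    refine Filter.eventuallyEq_set.2 (hae.mono fun x hx => ?_)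
    rw [hUpre] at hx
    have hdis : x ∈ A → x ∉ (· + a) ⁻¹' A := hM.add_notMem_of_mem ha
    simp only [mem_inter_iff, mem_compl_iff] at hx ⊢
    tauto
  have hinv : (· + (a + a)) ⁻¹' A =ᵐ[μ] A := by
    have h1 : (· + a) ⁻¹' ((· + a) ⁻¹' A) =ᵐ[μ] (· + a) ⁻¹' Aᶜ :=
      hpres.quasiMeasurePreserving.preimage_ae_eq hcompl
    have h2 : (· + a) ⁻¹' ((· + a) ⁻¹' A) = (· + (a + a)) ⁻¹' A := by
      ext x; simp [add_assoc]
    have h3 : (· + a) ⁻¹' Aᶜ =ᵐ[μ] (Aᶜᶜ : Set G) := by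
      rw [preimage_compl]; exact hcompl.compl
    rw [h2] at h1
    simpa using h1.trans h3
  have hmeas : μ A = μ Aᶜ := by
    rw [← measure_congr hcompl, hpres.measure_preimage hA.nullMeasurableSet]
  have huniv : μ univ ≠ 0 := by simpa using NeZero.ne μ
  have hsum : μ A + μ Aᶜ = μ univ := measure_add_measure_compl hA
  rcases herg.quasiErgodic.ae_empty_or_univ₀ hA.nullMeasurableSet hinv with h | h
  · have h0 : μ A = 0 := by simpa using measure_congr h
    rw [← hmeas, h0, add_zero] at hsum
    exact huniv hsum.symm
  · have h0 : μ Aᶜ = 0 := by simpa using measure_congr h.compl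
    rw [hmeas, h0, add_zero] at hsum
    exact huniv hsum.symm

end Matching

/-- There is a 2-regular Borel graph on a standard Borel space
all of whose Borel matchings admit a finite augmenting path. -/
theorem stmt3 :
    ∃ (X : Type) (mX : MeasurableSpace X), @StandardBorelSpace X mX ∧
      ∃ E : Set (X × X), @IsBorelGraph X mX E ∧
        (∀ x : X, ({y : X | (x, y) ∈ E}).Finite ∧ ({y : X | (x, y) ∈ E}).ncard = 2) ∧
        ∀ M : Set (X × X), @IsBorelMatching X mX E M →
          ∃ (k : ℕ) (p : ℕ → X), IsAugPathB E M k p := by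
  set a : UnitAddCircle := ((√2 : ℝ) : UnitAddCircle)
  have hord : ¬ IsOfFinAddOrder a := by
    rw [AddCircle.not_isOfFinAddOrder_iff_forall_rat_ne_div]
    intro q hq
    exact irrational_sqrt_two ⟨q, by simpa using hq⟩
  have ha : Function.Injective fun n : ℕ => n • a :=
    injective_nsmul_iff_not_isOfFinAddOrder.2 hord
  have ha0 : a ≠ 0 := fun h => hord (h ▸ IsOfFinAddOrder.zero)
  have herg : Ergodic (· + (a + a)) (volume : Measure UnitAddCircle) := by
    rw [AddCircle.ergodic_add_right, addOrderOf_eq_zero_iff, ← two_nsmul]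
    exact fun h => hord (h.of_nsmul two_ne_zero)
  refine ⟨UnitAddCircle, inferInstance, inferInstance, translationGraph a,
    isBorelGraph_translationGraph ha0, fun x => ?_, fun M hM => ?_⟩
  · rw [neighborSet_translationGraph]
    refine ⟨toFinite _, ncard_pair fun h => ?_⟩
    exact add_add_self_ne_of_injective_nsmul ha x (eq_sub_iff_add_eq.1 h)
  · obtain ⟨x, hx, hn⟩ :=
      hM.exists_notMem_matchedSetB ha (measurePreserving_add_right volume a) herg
    exact hM.exists_isAugPathB ha hx hn
end

section
/- Let {G_n} be a sequence of finite simple graphs with all vertex degrees at most d and with |V(G_n)| → ∞, which is convergent in the sense of Benjamini–Schramm: for every r ≥ 1 and every rooted isomorphism class α of rooted (r,d)-balls, the sequence p_{G_n}(α) converges as n → ∞. Then the sequence m(G_n) = |M(G_n)|/|V(G_n)| converges, where M(G_n) is a maximum matching of G_n. -/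
/-- The ball of radius `r` around `v` in `G`: all vertices joined to `v` by a
walk of length at most `r`. -/
def ballVerts {V : Type*} (G : SimpleGraph V) (v : V) (r : ℕ) : Set V :=
  {u : V | ∃ w : G.Walk v u, w.length ≤ r}

/-- The rooted `r`-ball around `v` in `G` (the subgraph induced on `ballVerts`,
rooted at `v`) is rooted-isomorphic to the rooted graph `(H, root)`. -/
def RootedBallIso {V : Type*} (G : SimpleGraph V) (v : V) (r : ℕ)
    {m : ℕ} (H : SimpleGraph (Fin m)) (root : Fin m) : Prop :=
  ∃ φ : ballVerts G v r ≃ Fin m,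
    (∃ hv : v ∈ ballVerts G v r, φ ⟨v, hv⟩ = root) ∧
    ∀ a b : ballVerts G v r, G.Adj a b ↔ H.Adj (φ a) (φ b)

/-- The number of edges in a maximum matching of the finite graph `G`. -/
noncomputable def matchNum {V : Type*} [Fintype V] (G : SimpleGraph V) : ℕ :=
  sSup {n : ℕ | ∃ M : Set (Sym2 V), IsGraphMatching G M ∧ M.ncard = n}

open scoped Classical in
/-- The depth-`k` truncation of the path-tree recursion for the probability that `v` is unmatched
in the monomer-dimer model of activity `t` on the subgraph of `G` induced on `S`. -/
noncomputable def truncUnmatched {V : Type*} (G : SimpleGraph V) (t : ℝ) :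
    ℕ → Finset V → V → ℝ
  | 0, _, _ => 1
  | k + 1, S, v =>
    (1 + t * ∑ u ∈ (S.erase v).filter (G.Adj v), truncUnmatched G t k (S.erase v) u)⁻¹

open scoped Classical in
/-- The matchings of `G` all of whose edges lie inside `S`. -/
noncomputable def matchingsIn {V : Type*} [Fintype V] (G : SimpleGraph V) (S : Finset V) :
    Finset (Finset (Sym2 V)) :=
  Finset.univ.filter fun M => IsGraphMatching G (M : Set (Sym2 V)) ∧ ∀ e ∈ M, ∀ v ∈ e, v ∈ S

/-- The monomer-dimer partition function of activity `t` on the subgraph induced on `S`. -/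
noncomputable def partitionFn {V : Type*} [Fintype V] (G : SimpleGraph V) (t : ℝ)
    (S : Finset V) : ℝ :=
  ∑ M ∈ matchingsIn G S, t ^ M.card

open scoped Classical in
/-- The probability that `v` is unmatched in the monomer-dimer model of activity `t` on the
subgraph induced on `S`. -/
noncomputable def unmatchedProb {V : Type*} [Fintype V] (G : SimpleGraph V) (t : ℝ)
    (S : Finset V) (v : V) : ℝ :=
  partitionFn G t (S.erase v) / partitionFn G t S

section MonomerDimer

variable {V : Type*} [Fintype V] {G : SimpleGraph V} {t : ℝ} {S : Finset V} {v : V}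

lemma mem_matchingsIn {M : Finset (Sym2 V)} :
    M ∈ matchingsIn G S ↔
      IsGraphMatching G (M : Set (Sym2 V)) ∧ ∀ e ∈ M, ∀ v ∈ e, v ∈ S := by
  classical
  simp [matchingsIn]

lemma empty_mem_matchingsIn : ∅ ∈ matchingsIn G S := by
  rw [mem_matchingsIn]
  simp [IsGraphMatching]

lemma partitionFn_pos (ht : 0 < t) : 0 < partitionFn G t S :=
  Finset.sum_pos (fun _ _ => pow_pos ht _) ⟨∅, empty_mem_matchingsIn⟩

open scoped Classical in
lemma filter_unmatched_matchingsIn :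
    (matchingsIn G S).filter (fun M => ¬ ∃ e ∈ M, v ∈ e) = matchingsIn G (S.erase v) := by
  ext M
  simp only [Finset.mem_filter, mem_matchingsIn, Finset.mem_erase]
  constructor
  · rintro ⟨⟨h1, h2⟩, h3⟩
    refine ⟨h1, fun e he w hw => ⟨?_, h2 e he w hw⟩⟩
    rintro rfl
    exact h3 ⟨e, he, hw⟩
  · rintro ⟨h1, h2⟩
    refine ⟨⟨h1, fun e he w hw => (h2 e he w hw).2⟩, ?_⟩
    rintro ⟨e, he, hv⟩
    exact (h2 e he v hv).1 rfl

open scoped Classical in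
lemma partitionFn_sub_erase (v : V) :
    partitionFn G t S - partitionFn G t (S.erase v) =
      ∑ M ∈ matchingsIn G S, if ∃ e ∈ M, v ∈ e then t ^ M.card else 0 := by
  have h := Finset.sum_filter_add_sum_filter_not (matchingsIn G S)
    (fun M => ∃ e ∈ M, v ∈ e) (fun M => t ^ M.card)
  rw [filter_unmatched_matchingsIn] at h
  rw [← Finset.sum_filter, partitionFn, partitionFn, ← h]
  ring

open scoped Classical in
lemma sum_filter_edge_mem {u : V} (hv : v ∈ S) (hu : u ∈ S) (huv : G.Adj v u) :
    ∑ M ∈ (matchingsIn G S).filter (fun M => s(v, u) ∈ M), t ^ M.card =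
      t * partitionFn G t ((S.erase v).erase u) := by
  have hne : ∀ M ∈ matchingsIn G ((S.erase v).erase u), s(v, u) ∉ M := by
    intro M hM he
    have := (mem_matchingsIn.1 hM).2 _ he v (Sym2.mem_mk_left v u)
    simp at this
  rw [partitionFn, Finset.mul_sum]
  refine Finset.sum_nbij' (fun M => M.erase s(v, u)) (fun M => insert s(v, u) M) ?_ ?_ ?_ ?_ ?_
  · intro M hM
    rw [Finset.mem_filter, mem_matchingsIn] at hM
    obtain ⟨⟨⟨h1, h2⟩, h3⟩, h4⟩ := hM
    rw [mem_matchingsIn]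
    refine ⟨⟨fun e he => h1 (Finset.mem_of_mem_erase he), fun e he f hf =>
      h2 e (Finset.mem_of_mem_erase he) f (Finset.mem_of_mem_erase hf)⟩, fun e he w hw => ?_⟩
    rw [Finset.mem_erase] at he
    have h5 := h2 e he.2 _ h4 he.1 w hw
    rw [Sym2.mem_iff, not_or] at h5
    simp [h5.1, h5.2, h3 e he.2 w hw]
  · intro M hM
    rw [mem_matchingsIn] at hM
    obtain ⟨⟨h1, h2⟩, h3⟩ := hM
    rw [Finset.mem_filter, mem_matchingsIn]
    refine ⟨⟨⟨?_, ?_⟩, ?_⟩, Finset.mem_insert_self _ _⟩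
    · intro e he
      rw [Finset.mem_coe, Finset.mem_insert] at he
      rcases he with rfl | he
      · exact huv
      · exact h1 he
    · have h6 : ∀ e ∈ M, ∀ w ∈ e, w ∉ s(v, u) := by
        intro e he w hw
        have := h3 e he w hw
        simp only [Finset.mem_erase] at this
        simp [this.1, this.2.1]
      intro e he f hf hef w hwe hwf
      rw [Finset.mem_coe, Finset.mem_insert] at he hf
      rcases he with rfl | he <;> rcases hf with rfl | hf
      · exact hef rfl
      · exact h6 f hf w hwf hwe
      · exact h6 e he w hwe hwf
      · exact h2 e he f hf hef w hwe hwf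
    · intro e he w hw
      rw [Finset.mem_insert] at he
      rcases he with rfl | he
      · rcases Sym2.mem_iff.1 hw with rfl | rfl <;> assumption
      · exact Finset.mem_of_mem_erase (Finset.mem_of_mem_erase (h3 e he w hw))
  · intro M hM
    exact Finset.insert_erase (Finset.mem_filter.1 hM).2
  · intro M hM
    exact Finset.erase_insert (hne M hM)
  · intro M hM
    rw [← pow_succ', Finset.card_erase_add_one (Finset.mem_filter.1 hM).2]

open scoped Classical in
lemma sum_edge_mem_eq {M : Finset (Sym2 V)} (hM : M ∈ matchingsIn G S) (c : ℝ) :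
    ∑ u ∈ (S.erase v).filter (G.Adj v), (if s(v, u) ∈ M then c else 0) =
      if ∃ e ∈ M, v ∈ e then c else 0 := by
  rw [mem_matchingsIn] at hM
  obtain ⟨⟨h1, h2⟩, h3⟩ := hM
  split_ifs with h
  · obtain ⟨e, he, hv⟩ := h
    obtain ⟨u, rfl⟩ := Sym2.mem_iff_exists.1 hv
    have hadj : G.Adj v u := h1 he
    rw [Finset.sum_eq_single_of_mem u, if_pos he]
    · simp [hadj, hadj.ne', h3 _ he u (Sym2.mem_mk_right v u)]
    · intro w _ hw
      rw [if_neg]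
      intro hw'
      refine h2 _ he _ hw' ?_ v hv (Sym2.mem_mk_left v w)
      intro heq
      exact hw (Sym2.congr_right.1 heq).symm
  · refine Finset.sum_eq_zero fun u _ => if_neg fun hu => h ⟨_, hu, Sym2.mem_mk_left v u⟩

open scoped Classical in
lemma partitionFn_eq_add (hv : v ∈ S) :
    partitionFn G t S = partitionFn G t (S.erase v) +
      t * ∑ u ∈ (S.erase v).filter (G.Adj v), partitionFn G t ((S.erase v).erase u) := by
  rw [← sub_eq_iff_eq_add', partitionFn_sub_erase, Finset.mul_sum,
    ← Finset.sum_congr rfl fun M hM => sum_edge_mem_eq hM (t ^ M.card), Finset.sum_comm]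
  refine Finset.sum_congr rfl fun u hu => ?_
  rw [Finset.mem_filter, Finset.mem_erase] at hu
  rw [← Finset.sum_filter, sum_filter_edge_mem hv hu.1.2 hu.2]

open scoped Classical in
/-- The probability that `v` is unmatched satisfies the path-tree recursion. -/
lemma unmatchedProb_eq (ht : 0 < t) (hv : v ∈ S) :
    unmatchedProb G t S v =
      (1 + t * ∑ u ∈ (S.erase v).filter (G.Adj v), unmatchedProb G t (S.erase v) u)⁻¹ := by
  simp only [unmatchedProb]
  have h := partitionFn_pos (G := G) (S := S.erase v) ht
  rw [← Finset.sum_div, partitionFn_eq_add hv, ← inv_div]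
  congr 1
  field_simp

open scoped Classical in
lemma card_matched_eq {M : Finset (Sym2 V)} (hM : M ∈ matchingsIn G S) :
    (Finset.univ.filter fun v : V => ∃ e ∈ M, v ∈ e).card = 2 * M.card := by
  rw [mem_matchingsIn] at hM
  obtain ⟨⟨h1, h2⟩, -⟩ := hM
  have : (Finset.univ.filter fun v : V => ∃ e ∈ M, v ∈ e) = M.biUnion Sym2.toFinset := by
    ext v
    simp
  rw [this, Finset.card_biUnion, Finset.sum_congr rfl (g := fun _ => 2)]
  · simp [mul_comm]
  · intro e he
    exact Sym2.card_toFinset_of_not_isDiag e (G.not_isDiag_of_mem_edgeSet (h1 he))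
  · intro e he f hf hef
    refine Finset.disjoint_left.2 ?_
    intro v hv hv'
    exact h2 e he f hf hef v (Sym2.mem_toFinset.1 hv) (Sym2.mem_toFinset.1 hv')

open scoped Classical in
/-- Twice the expected size of a random matching is the expected number of matched vertices. -/
lemma two_mul_sum_card_eq (ht : 0 < t) :
    2 * ∑ M ∈ matchingsIn G Finset.univ, (M.card : ℝ) * t ^ M.card =
      partitionFn G t Finset.univ * ∑ v : V, (1 - unmatchedProb G t Finset.univ v) := by
  have h := (partitionFn_pos (G := G) (S := Finset.univ) ht).ne'
  rw [Finset.mul_sum, Finset.mul_sum]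
  have : ∀ v : V, partitionFn G t Finset.univ *
      (1 - unmatchedProb G t Finset.univ v) =
      ∑ M ∈ matchingsIn G Finset.univ, if ∃ e ∈ M, v ∈ e then t ^ M.card else 0 := by
    intro v
    rw [← partitionFn_sub_erase, unmatchedProb]
    field_simp
  simp_rw [this]
  rw [Finset.sum_comm]
  refine Finset.sum_congr rfl fun M hM => ?_
  rw [← Finset.sum_filter, Finset.sum_const, card_matched_eq hM, nsmul_eq_mul]
  push_cast
  ring

end MonomerDimer

section Contraction

variable {V : Type*} {G : SimpleGraph V} {t : ℝ} {S : Finset V} {v : V} {d : ℕ}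

lemma truncUnmatched_nonneg (ht : 0 < t) (k : ℕ) (S : Finset V) (v : V) :
    0 ≤ truncUnmatched G t k S v := by
  classical
  induction k generalizing S v with
  | zero => simp [truncUnmatched]
  | succ k ih =>
    rw [truncUnmatched]
    have := Finset.sum_nonneg fun u (_ : u ∈ (S.erase v).filter (G.Adj v)) => ih (S.erase v) u
    positivity

lemma truncUnmatched_le_one (ht : 0 < t) (k : ℕ) (S : Finset V) (v : V) :
    truncUnmatched G t k S v ≤ 1 := by
  classical
  cases k with
  | zero => simp [truncUnmatched]
  | succ k =>
    rw [truncUnmatched]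
    have := Finset.sum_nonneg fun u (_ : u ∈ (S.erase v).filter (G.Adj v)) =>
      truncUnmatched_nonneg (G := G) ht k (S.erase v) u
    exact inv_le_one_of_one_le₀ (le_add_of_nonneg_right (by positivity))

lemma inv_one_add_le_mul_inv {D q x y : ℝ} (hx : 0 ≤ x) (hy : 0 ≤ y) (hq : 0 ≤ q)
    (hxD : x ≤ D) (hyx : y ≤ (1 + q) * x) :
    (1 + x)⁻¹ ≤ (1 + D / (1 + D) * q) * (1 + y)⁻¹ := by
  have hD : 0 < 1 + D := by linarith
  have hc : x ≤ D / (1 + D) * (1 + x) := by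
    rw [div_mul_eq_mul_div, le_div_iff₀ hD]
    linarith
  rw [← div_eq_mul_inv, le_div_iff₀ (by positivity), inv_mul_le_iff₀ (by positivity)]
  nlinarith [mul_le_mul_of_nonneg_left hc hq]

lemma sum_adj_le [Fintype V] {A : Finset V} {f : V → ℝ} [DecidablePred (G.Adj v)]
    (hdeg : (G.neighborSet v).ncard ≤ d) (hf : ∀ u ∈ A, f u ≤ 1) :
    ∑ u ∈ A.filter (G.Adj v), f u ≤ d := by
  calc ∑ u ∈ A.filter (G.Adj v), f u ≤ ∑ u ∈ A.filter (G.Adj v), (1 : ℝ) :=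
        Finset.sum_le_sum fun u hu => hf u (Finset.mem_filter.1 hu).1
    _ = ((A.filter (G.Adj v)).card : ℝ) := by simp
    _ ≤ d := by
      rw [← Set.ncard_coe_finset]
      refine Nat.cast_le.2 (le_trans (Set.ncard_le_ncard ?_) hdeg)
      intro u hu
      exact (Finset.mem_filter.1 hu).2

variable [Fintype V]

lemma unmatchedProb_nonneg (ht : 0 < t) :
    0 ≤ unmatchedProb G t S v :=
  (div_pos (partitionFn_pos ht) (partitionFn_pos ht)).le

lemma unmatchedProb_le_one (ht : 0 < t) (hv : v ∈ S) :
    unmatchedProb G t S v ≤ 1 := by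
  classical
  rw [unmatchedProb_eq ht hv]
  have := Finset.sum_nonneg fun u (_ : u ∈ (S.erase v).filter (G.Adj v)) =>
    unmatchedProb_nonneg (G := G) (S := S.erase v) (v := u) ht
  exact inv_le_one_of_one_le₀ (le_add_of_nonneg_right (by positivity))

/-- The truncated recursion approximates the probability of being unmatched up to a factor that
tends to one exponentially fast in the depth. -/
lemma truncUnmatched_ratio (ht : 0 < t) (hdeg : ∀ v, (G.neighborSet v).ncard ≤ d) (k : ℕ)
    (hv : v ∈ S) :
    truncUnmatched G t k S v ≤ (1 + (t * d / (1 + t * d)) ^ k * (t * d)) *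
        unmatchedProb G t S v ∧
      unmatchedProb G t S v ≤
        (1 + (t * d / (1 + t * d)) ^ k * (t * d)) * truncUnmatched G t k S v := by
  classical
  have hD : 0 ≤ t * d := by positivity
  induction k generalizing S v with
  | zero =>
    have hle : ∀ u ∈ S.erase v, unmatchedProb G t (S.erase v) u ≤ 1 :=
      fun u hu => unmatchedProb_le_one ht hu
    have h1 := mul_le_mul_of_nonneg_left (sum_adj_le (hdeg v) hle) ht.le
    have h0 := Finset.sum_nonneg fun u (_ : u ∈ (S.erase v).filter (G.Adj v)) =>
      unmatchedProb_nonneg (G := G) (S := S.erase v) (v := u) ht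
    have h2 := unmatchedProb_le_one (G := G) ht hv
    simp only [truncUnmatched, pow_zero, one_mul, mul_one]
    refine ⟨?_, by linarith⟩
    rw [unmatchedProb_eq ht hv, ← div_eq_mul_inv, le_div_iff₀ (by positivity)]
    linarith
  | succ k ih =>
    have hq : 0 ≤ (t * d / (1 + t * d)) ^ k * (t * d) := by positivity
    set q := (t * d / (1 + t * d)) ^ k * (t * d)
    have hpow : (t * d / (1 + t * d)) ^ (k + 1) * (t * d) = t * d / (1 + t * d) * q := by
      rw [pow_succ]
      ring
    rw [hpow, unmatchedProb_eq ht hv, truncUnmatched]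
    have hx0 := Finset.sum_nonneg fun u (_ : u ∈ (S.erase v).filter (G.Adj v)) =>
      unmatchedProb_nonneg (G := G) (S := S.erase v) (v := u) ht
    have hy0 := Finset.sum_nonneg fun u (_ : u ∈ (S.erase v).filter (G.Adj v)) =>
      truncUnmatched_nonneg (G := G) ht k (S.erase v) u
    have hx1 : ∑ u ∈ (S.erase v).filter (G.Adj v), unmatchedProb G t (S.erase v) u ≤ d :=
      sum_adj_le (hdeg v) fun u hu => unmatchedProb_le_one ht hu
    have hy1 : ∑ u ∈ (S.erase v).filter (G.Adj v), truncUnmatched G t k (S.erase v) u ≤ d :=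
      sum_adj_le (hdeg v) fun u _ => truncUnmatched_le_one ht k _ u
    have hxy : ∑ u ∈ (S.erase v).filter (G.Adj v), unmatchedProb G t (S.erase v) u ≤
        (1 + q) * ∑ u ∈ (S.erase v).filter (G.Adj v), truncUnmatched G t k (S.erase v) u := by
      rw [Finset.mul_sum]
      exact Finset.sum_le_sum fun u hu => (ih (Finset.mem_filter.1 hu).1).2
    have hyx : ∑ u ∈ (S.erase v).filter (G.Adj v), truncUnmatched G t k (S.erase v) u ≤
        (1 + q) * ∑ u ∈ (S.erase v).filter (G.Adj v), unmatchedProb G t (S.erase v) u := by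
      rw [Finset.mul_sum]
      exact Finset.sum_le_sum fun u hu => (ih (Finset.mem_filter.1 hu).1).1
    constructor
    · refine inv_one_add_le_mul_inv (by positivity) (by positivity) hq
        (mul_le_mul_of_nonneg_left hy1 ht.le) ?_
      rw [mul_left_comm]
      exact mul_le_mul_of_nonneg_left hxy ht.le
    · refine inv_one_add_le_mul_inv (by positivity) (by positivity) hq
        (mul_le_mul_of_nonneg_left hx1 ht.le) ?_
      rw [mul_left_comm]
      exact mul_le_mul_of_nonneg_left hyx ht.le

lemma abs_sub_truncUnmatched_le (ht : 0 < t) (hdeg : ∀ v, (G.neighborSet v).ncard ≤ d) (k : ℕ)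
    (hv : v ∈ S) :
    |unmatchedProb G t S v - truncUnmatched G t k S v| ≤
      (t * d / (1 + t * d)) ^ k * (t * d) := by
  obtain ⟨h1, h2⟩ := truncUnmatched_ratio ht hdeg k hv
  have hq : 0 ≤ (t * d / (1 + t * d)) ^ k * (t * d) := by positivity
  have h3 := truncUnmatched_le_one (G := G) ht k S v
  have h4 := unmatchedProb_le_one (G := G) ht hv
  rw [abs_le]
  constructor <;> nlinarith

end Contraction

section MaximumMatching

variable {V : Type*} [Fintype V] {G : SimpleGraph V} {t : ℝ} {d : ℕ}

lemma exists_card_eq_matchNum (G : SimpleGraph V) :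
    (∃ M ∈ matchingsIn G Finset.univ, M.card = matchNum G) ∧
      ∀ M ∈ matchingsIn G Finset.univ, M.card ≤ matchNum G := by
  classical
  have hbdd : BddAbove {n : ℕ | ∃ M : Set (Sym2 V), IsGraphMatching G M ∧ M.ncard = n} := by
    refine ⟨Nat.card (Sym2 V), ?_⟩
    rintro n ⟨M, -, rfl⟩
    exact Set.ncard_le_card M
  constructor
  · obtain ⟨M, hM, hcard⟩ := Nat.sSup_mem
      (s := {n : ℕ | ∃ M : Set (Sym2 V), IsGraphMatching G M ∧ M.ncard = n})
      ⟨0, ∅, by simp [IsGraphMatching], by simp⟩ hbdd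
    refine ⟨M.toFinset, ?_, ?_⟩
    · rw [mem_matchingsIn]
      simpa using hM
    · rw [← Set.ncard_eq_toFinset_card', hcard, matchNum]
  · intro M hM
    exact le_csSup hbdd ⟨M, (mem_matchingsIn.1 hM).1, Set.ncard_coe_finset M⟩

lemma card_matchingsIn_le (hdeg : ∀ v, (G.neighborSet v).ncard ≤ d) :
    (matchingsIn G Finset.univ).card ≤ 2 ^ (d * Fintype.card V) := by
  classical
  have h1 : matchingsIn G Finset.univ ⊆ G.edgeFinset.powerset := by
    intro M hM
    rw [Finset.mem_powerset]
    intro e he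
    exact SimpleGraph.mem_edgeFinset.2 ((mem_matchingsIn.1 hM).1.1 he)
  have h2 : 2 * G.edgeFinset.card ≤ d * Fintype.card V := by
    rw [← G.sum_degrees_eq_twice_card_edges, mul_comm, ← smul_eq_mul, ← Finset.card_univ]
    refine Finset.sum_le_card_nsmul _ _ _ fun v _ => ?_
    rw [← G.card_neighborSet_eq_degree, ← Nat.card_eq_fintype_card]
    exact hdeg v
  calc _ ≤ G.edgeFinset.powerset.card := Finset.card_le_card h1
    _ = 2 ^ G.edgeFinset.card := Finset.card_powerset _
    _ ≤ _ := Nat.pow_le_pow_right (by norm_num) (by omega)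

/-- At large activity the expected size of a random matching is close to the maximum. -/
lemma abs_matchNum_sub_le (ht : 1 < t) (hdeg : ∀ v, (G.neighborSet v).ncard ≤ d) :
    |(matchNum G : ℝ) - (∑ v : V, (1 - unmatchedProb G t Finset.univ v)) / 2| ≤
      d * Real.log 2 / Real.log t * Fintype.card V := by
  have ht0 : 0 < t := by linarith
  have hlog : 0 < Real.log t := Real.log_pos ht
  have hZ : 0 < partitionFn G t Finset.univ := partitionFn_pos ht0
  obtain ⟨⟨M₀, hM₀, hM₀card⟩, hle⟩ := exists_card_eq_matchNum G
  have hE := two_mul_sum_card_eq (G := G) ht0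
  set E := ∑ v : V, (1 - unmatchedProb G t Finset.univ v)
  set A : ℝ := 2 ^ (d * Fintype.card V) with hA
  have hApos : 0 < A := by positivity
  have hlogA : Real.log A = d * Fintype.card V * Real.log 2 := by
    rw [hA, Real.log_pow]
    push_cast
    ring
  have hcard : ((matchingsIn G Finset.univ).card : ℝ) ≤ A := by
    rw [hA]
    exact_mod_cast card_matchingsIn_le hdeg
  have hmax : t ^ matchNum G ≤ partitionFn G t Finset.univ := by
    rw [← hM₀card]
    exact Finset.single_le_sum (f := fun M => t ^ M.card) (fun _ _ => by positivity) hM₀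
  have hsum : ∑ M ∈ matchingsIn G Finset.univ, ((matchNum G : ℝ) - M.card) * t ^ M.card =
      partitionFn G t Finset.univ * (matchNum G - E / 2) := by
    simp_rw [sub_mul]
    rw [Finset.sum_sub_distrib, ← Finset.mul_sum, mul_sub]
    rw [partitionFn] at hE ⊢
    linarith
  have hlower : 0 ≤ matchNum G - E / 2 := by
    refine nonneg_of_mul_nonneg_right ?_ hZ
    rw [← hsum]
    refine Finset.sum_nonneg fun M hM => mul_nonneg ?_ (by positivity)
    exact sub_nonneg.2 (Nat.cast_le.2 (hle M hM))
  have hterm : ∀ M ∈ matchingsIn G Finset.univ,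
      (((matchNum G : ℝ) - M.card) * t ^ M.card) * Real.log t ≤
        t ^ matchNum G / A - t ^ M.card + t ^ M.card * Real.log A := by
    intro M hM
    have hpow : 0 < t ^ M.card := by positivity
    have hlog' := Real.log_le_sub_one_of_pos
      (x := t ^ matchNum G / (t ^ M.card * A)) (by positivity)
    rw [Real.log_div (by positivity) (by positivity), Real.log_mul (by positivity) (by positivity),
      Real.log_pow, Real.log_pow] at hlog'
    have := mul_le_mul_of_nonneg_left hlog' hpow.le
    have heq : t ^ M.card * (t ^ matchNum G / (t ^ M.card * A) - 1) =
        t ^ matchNum G / A - t ^ M.card := by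
      field_simp
    rw [heq] at this
    linarith
  have htotal := Finset.sum_le_sum hterm
  rw [← Finset.sum_mul, hsum, Finset.sum_add_distrib, Finset.sum_sub_distrib, ← Finset.sum_mul,
    Finset.sum_const, nsmul_eq_mul] at htotal
  have hcount : ((matchingsIn G Finset.univ).card : ℝ) * (t ^ matchNum G / A) ≤
      partitionFn G t Finset.univ := by
    refine le_trans ?_ hmax
    rw [mul_div_assoc', div_le_iff₀ hApos, mul_comm]
    exact mul_le_mul_of_nonneg_left hcard (by positivity)
  have hfinal : partitionFn G t Finset.univ * ((matchNum G - E / 2) * Real.log t) ≤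
      partitionFn G t Finset.univ * Real.log A := by
    rw [partitionFn] at hcount htotal ⊢
    linarith
  have hupper := le_of_mul_le_mul_left hfinal hZ
  rw [abs_of_nonneg hlower, div_mul_eq_mul_div, le_div_iff₀ hlog]
  linarith

end MaximumMatching

section Locality

variable {V : Type*} {G : SimpleGraph V} {t : ℝ} {d : ℕ}

lemma self_mem_ballVerts (G : SimpleGraph V) (v : V) (r : ℕ) : v ∈ ballVerts G v r :=
  ⟨SimpleGraph.Walk.nil, Nat.zero_le _⟩

lemma ballVerts_subset_of_adj {u v : V} (h : G.Adj v u) (r : ℕ) :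
    ballVerts G u r ⊆ ballVerts G v (r + 1) := by
  rintro w ⟨p, hp⟩
  exact ⟨SimpleGraph.Walk.cons h p, by simpa using hp⟩

/-- The truncated recursion only depends on the isomorphism type of a ball. -/
lemma truncUnmatched_eq_of_equiv {W : Type*} {H : SimpleGraph W} {B : Set V} (φ : B ≃ W)
    (hφ : ∀ a b : B, G.Adj a b ↔ H.Adj (φ a) (φ b)) (k : ℕ) (S : Finset V) (S' : Finset W)
    (hS : ∀ b : B, (b : V) ∈ S ↔ φ b ∈ S') (w : B) (hw : ballVerts G w k ⊆ B) :
    truncUnmatched G t k S w = truncUnmatched H t k S' (φ w) := by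
  classical
  induction k generalizing S S' w with
  | zero => simp [truncUnmatched]
  | succ k ih =>
    have hS' : ∀ b : B, (b : V) ∈ S.erase w ↔ φ b ∈ S'.erase (φ w) := by
      intro b
      simp [hS b, Subtype.ext_iff]
    have hball : ∀ u, G.Adj w u → ballVerts G u k ⊆ B := fun u hu =>
      (ballVerts_subset_of_adj hu k).trans hw
    have hmem : ∀ u ∈ (S.erase w).filter (G.Adj w), u ∈ B := fun u hu =>
      hball u (Finset.mem_filter.1 hu).2 (self_mem_ballVerts G u k)
    rw [truncUnmatched, truncUnmatched]
    congr 3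
    refine Finset.sum_bij (fun u hu => φ ⟨u, hmem u hu⟩) ?_ ?_ ?_ ?_
    · intro u hu
      have hu' := Finset.mem_filter.1 hu
      exact Finset.mem_filter.2 ⟨(hS' ⟨u, hmem u hu⟩).1 hu'.1, (hφ w ⟨u, hmem u hu⟩).1 hu'.2⟩
    · intro u hu u' hu' h
      simpa using h
    · intro x hx
      have hx' := Finset.mem_filter.1 hx
      refine ⟨φ.symm x, Finset.mem_filter.2 ⟨?_, ?_⟩, by simp⟩
      · rw [hS']
        simpa using hx'.1
      · rw [hφ]
        simpa using hx'.2
    · intro u hu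
      exact ih _ _ hS' ⟨u, hmem u hu⟩ (hball u (Finset.mem_filter.1 hu).2)

lemma truncUnmatched_eq_of_rootedBallIso [Fintype V] {v : V} {r m : ℕ}
    {H : SimpleGraph (Fin m)} {root : Fin m} (h : RootedBallIso G v r H root) :
    truncUnmatched G t r Finset.univ v = truncUnmatched H t r Finset.univ root := by
  obtain ⟨φ, ⟨hv, rfl⟩, hφ⟩ := h
  exact truncUnmatched_eq_of_equiv φ hφ r _ _ (by simp) ⟨v, hv⟩ subset_rfl

lemma ncard_ballVerts_le [Finite V] (hdeg : ∀ v, (G.neighborSet v).ncard ≤ d) (r : ℕ) (v : V) :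
    (ballVerts G v r).ncard ≤ (d + 1) ^ r := by
  classical
  cases nonempty_fintype V
  induction r with
  | zero =>
    have : ballVerts G v 0 ⊆ {v} := by
      rintro u ⟨p, hp⟩
      exact (SimpleGraph.Walk.eq_of_length_eq_zero (Nat.le_zero.1 hp)).symm
    simpa using Set.ncard_le_ncard this
  | succ r ih =>
    have hsub : ballVerts G v (r + 1) ⊆
        ↑((ballVerts G v r).toFinset.biUnion fun u => insert u (G.neighborFinset u)) := by
      rintro u ⟨p, hp⟩
      simp only [Finset.coe_biUnion, Set.mem_iUnion, Set.coe_toFinset]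
      rcases Nat.lt_or_ge r p.length with h | h
      · have hnil : ¬ p.Nil := by
          rw [← SimpleGraph.Walk.length_eq_zero_iff]
          omega
        refine ⟨p.penultimate, ⟨p.dropLast, ?_⟩, ?_⟩
        · have := p.length_dropLast_add_one hnil
          omega
        · simp [p.adj_penultimate hnil]
      · exact ⟨u, ⟨p, h⟩, by simp⟩
    calc _ ≤ ((ballVerts G v r).toFinset.biUnion fun u => insert u (G.neighborFinset u)).card := by
          rw [← Set.ncard_coe_finset]
          exact Set.ncard_le_ncard hsub
      _ ≤ (ballVerts G v r).toFinset.card * (d + 1) := by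
          refine Finset.card_biUnion_le_card_mul _ _ _ fun u _ => ?_
          refine (Finset.card_insert_le _ _).trans (Nat.succ_le_succ ?_)
          rw [G.card_neighborFinset_eq_degree, ← G.card_neighborSet_eq_degree,
            ← Nat.card_eq_fintype_card]
          exact hdeg u
      _ ≤ (d + 1) ^ (r + 1) := by
          rw [← Set.ncard_eq_toFinset_card', pow_succ]
          exact Nat.mul_le_mul_right _ ih

end Locality

section RootedGraph

/-- Rooted graphs on `Fin m` with `m ≤ N`. -/
abbrev SmallRootedGraph (N : ℕ) : Type :=
  Σ m : Fin (N + 1), SimpleGraph (Fin m) × Fin m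

/-- Rooted isomorphism of small rooted graphs. -/
def rootedIsoSetoid (N : ℕ) : Setoid (SmallRootedGraph N) where
  r τ τ' := ∃ ψ : Fin τ.1 ≃ Fin τ'.1, ψ τ.2.2 = τ'.2.2 ∧
    ∀ a b, τ.2.1.Adj a b ↔ τ'.2.1.Adj (ψ a) (ψ b)
  iseqv :=
    { refl := fun _ => ⟨Equiv.refl _, rfl, fun _ _ => Iff.rfl⟩
      symm := by
        rintro τ τ' ⟨ψ, h1, h2⟩
        exact ⟨ψ.symm, by simp [← h1], fun a b => by simp [h2]⟩
      trans := by
        rintro τ τ' τ'' ⟨ψ, h1, h2⟩ ⟨χ, h3, h4⟩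
        exact ⟨ψ.trans χ, by simp [h1, h3], fun a b => by simp [h2, h4]⟩ }

variable {V : Type*} {G : SimpleGraph V} {v : V} {r N : ℕ}

lemma rootedBallIso_iff {τ τ' : SmallRootedGraph N} (h : RootedBallIso G v r τ.2.1 τ.2.2) :
    RootedBallIso G v r τ'.2.1 τ'.2.2 ↔ (rootedIsoSetoid N).r τ τ' := by
  obtain ⟨φ, ⟨hv, hroot⟩, hφ⟩ := h
  constructor
  · rintro ⟨φ', ⟨hv', hroot'⟩, hφ'⟩
    refine ⟨φ.symm.trans φ', ?_, fun a b => ?_⟩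
    · rw [← hroot, ← hroot']
      simp
    · simp [← hφ', hφ]
  · rintro ⟨ψ, h1, h2⟩
    exact ⟨φ.trans ψ, ⟨hv, by simp [hroot, h1]⟩, fun a b => by simp [hφ, h2]⟩

lemma exists_rootedBallIso [Finite V] (h : (ballVerts G v r).ncard ≤ N) :
    ∃ τ : SmallRootedGraph N, RootedBallIso G v r τ.2.1 τ.2.2 := by
  let φ : ballVerts G v r ≃ Fin (ballVerts G v r).ncard := Finite.equivFin _
  refine ⟨⟨⟨_, Nat.lt_succ_of_le h⟩, G.comap fun x => (φ.symm x : V),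
    φ ⟨v, self_mem_ballVerts G v r⟩⟩, φ, ⟨self_mem_ballVerts G v r, rfl⟩, fun a b => ?_⟩
  simp

end RootedGraph

/-- Along a Benjamini-Schramm convergent sequence, averages of local functions converge. -/
lemma exists_tendsto_average {d r : ℕ} (V : ℕ → Type) [∀ n, Fintype (V n)]
    (G : ∀ n, SimpleGraph (V n)) (hdeg : ∀ (n : ℕ) (v : V n), ((G n).neighborSet v).ncard ≤ d)
    (hconv : ∀ (m : ℕ) (H : SimpleGraph (Fin m)) (root : Fin m),
      ∃ L : ℝ, Filter.Tendsto
        (fun n => (({v : V n | RootedBallIso (G n) v r H root}).ncard : ℝ) /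
          (Fintype.card (V n) : ℝ))
        Filter.atTop (nhds L))
    (f : ∀ n, V n → ℝ) (F : ∀ m, SimpleGraph (Fin m) → Fin m → ℝ)
    (hf : ∀ n v m H root, RootedBallIso (G n) v r (m := m) H root → f n v = F m H root) :
    ∃ L : ℝ, Filter.Tendsto (fun n => (∑ v, f n v) / (Fintype.card (V n) : ℝ))
      Filter.atTop (nhds L) := by
  classical
  let N := (d + 1) ^ r
  let Q := Quotient (rootedIsoSetoid N)
  have : Fintype Q := Fintype.ofFinite Q
  choose τ hτ using fun n (v : V n) => exists_rootedBallIso (ncard_ballVerts_le (hdeg n) r v)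
  let cls : ∀ n, V n → Q := fun n v => Quotient.mk _ (τ n v)
  have hcls : ∀ n (v : V n) (q : Q),
      cls n v = q ↔ RootedBallIso (G n) v r q.out.2.1 q.out.2.2 := by
    intro n v q
    rw [rootedBallIso_iff (hτ n v)]
    conv_lhs => rw [← Quotient.out_eq q]
    exact Quotient.eq
  choose L hL using fun q : Q => hconv q.out.1 q.out.2.1 q.out.2.2
  refine ⟨∑ q : Q, F _ q.out.2.1 q.out.2.2 * L q, ?_⟩
  refine (tendsto_finsetSum _ fun q _ => (hL q).const_mul (F _ q.out.2.1 q.out.2.2)).congr ?_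
  intro n
  rw [← Finset.sum_fiberwise Finset.univ (cls n), Finset.sum_div]
  refine Finset.sum_congr rfl fun q _ => ?_
  have hset : {v : V n | RootedBallIso (G n) v r q.out.2.1 q.out.2.2} =
      ↑(Finset.univ.filter fun v => cls n v = q) := by
    ext v
    simp [hcls]
  rw [hset, Set.ncard_coe_finset, ← mul_div_assoc, Finset.sum_congr rfl fun v hv =>
    hf n v _ _ _ ((hcls n v q).1 (Finset.mem_filter.1 hv).2), Finset.sum_const, nsmul_eq_mul,
    mul_comm]

/-- A real sequence that is uniformly approximated by convergent sequences converges. -/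
lemma exists_tendsto_of_approx {x : ℕ → ℝ}
    (h : ∀ ε > 0, ∃ y : ℕ → ℝ, (∃ L, Filter.Tendsto y Filter.atTop (nhds L)) ∧
      ∀ n, |x n - y n| ≤ ε) :
    ∃ L, Filter.Tendsto x Filter.atTop (nhds L) := by
  refine cauchySeq_tendsto_of_complete (Metric.cauchySeq_iff.2 fun ε hε => ?_)
  obtain ⟨y, ⟨L, hL⟩, hy⟩ := h (ε / 4) (by positivity)
  obtain ⟨N, hN⟩ := Metric.cauchySeq_iff.1 hL.cauchySeq (ε / 4) (by positivity)
  refine ⟨N, fun m hm n hn => ?_⟩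
  have h1 := hN m hm n hn
  have h2 := hy m
  have h3 := hy n
  rw [Real.dist_eq, abs_lt] at *
  rw [abs_le] at h2 h3
  constructor <;> linarith

/-- If `(G n)` is a Benjamini–Schramm convergent sequence of
finite graphs with degrees at most `d` and `|V(G n)| → ∞`, then the maximum
matching ratios `m(G n)` converge. -/
theorem stmt7 (d : ℕ) (V : ℕ → Type) [∀ n, Fintype (V n)] (G : ∀ n, SimpleGraph (V n))
    (hdeg : ∀ (n : ℕ) (v : V n), ((G n).neighborSet v).ncard ≤ d)
    (hcard : Filter.Tendsto (fun n => Fintype.card (V n)) Filter.atTop Filter.atTop)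
    (hconv : ∀ r : ℕ, 1 ≤ r → ∀ (m : ℕ) (H : SimpleGraph (Fin m)) (root : Fin m),
      ∃ L : ℝ, Filter.Tendsto
        (fun n => (({v : V n | RootedBallIso (G n) v r H root}).ncard : ℝ) /
          (Fintype.card (V n) : ℝ))
        Filter.atTop (nhds L)) :
    ∃ L : ℝ, Filter.Tendsto
      (fun n => ((matchNum (G n) : ℝ) / (Fintype.card (V n) : ℝ)))
      Filter.atTop (nhds L) := by
  refine exists_tendsto_of_approx fun ε hε => ?_
  obtain ⟨t, ht1, ht⟩ : ∃ t : ℝ, 1 < t ∧ d * Real.log 2 / Real.log t ≤ ε / 2 := by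
    have h0 : Filter.Tendsto (fun t => d * Real.log 2 / Real.log t) Filter.atTop (nhds 0) :=
      Real.tendsto_log_atTop.const_div_atTop _
    exact ((Filter.eventually_gt_atTop 1).and
      (h0.eventually (eventually_le_nhds (by positivity)))).exists
  have ht0 : 0 < t := by linarith
  obtain ⟨k, hk1, hk⟩ : ∃ k : ℕ, 1 ≤ k ∧ (t * d / (1 + t * d)) ^ k * (t * d) ≤ ε := by
    have hD : 0 ≤ t * d := by positivity
    have h0 : Filter.Tendsto (fun k : ℕ => (t * d / (1 + t * d)) ^ k * (t * d))
        Filter.atTop (nhds 0) := by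
      have h1 : t * d / (1 + t * d) < 1 := by
        rw [div_lt_one (by positivity)]
        linarith
      simpa using (tendsto_pow_atTop_nhds_zero_of_lt_one (by positivity) h1).mul_const (t * d)
    exact ((Filter.eventually_ge_atTop 1).and (h0.eventually (eventually_le_nhds hε))).exists
  refine ⟨fun n => (∑ v, (1 - truncUnmatched (G n) t k Finset.univ v) / 2) /
    (Fintype.card (V n) : ℝ), ?_, fun n => ?_⟩
  · refine exists_tendsto_average V G hdeg (hconv k hk1) _
      (fun m H root => (1 - truncUnmatched H t k Finset.univ root) / 2) ?_
    intro n v m H root h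
    rw [truncUnmatched_eq_of_rootedBallIso h]
  · rw [← sub_div, abs_div, Nat.abs_cast]
    refine div_le_of_le_mul₀ (by positivity) hε.le ?_
    have h1 := abs_matchNum_sub_le ht1 (hdeg n)
    have h2 : |(∑ v, (1 - unmatchedProb (G n) t Finset.univ v)) / 2 -
        ∑ v, (1 - truncUnmatched (G n) t k Finset.univ v) / 2| ≤ ε / 2 * Fintype.card (V n) := by
      rw [Finset.sum_div, ← Finset.sum_sub_distrib]
      refine (Finset.abs_sum_le_sum_abs _ _).trans ?_
      rw [mul_comm, ← nsmul_eq_mul, ← Finset.card_univ]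
      refine Finset.sum_le_card_nsmul _ _ _ fun v _ => ?_
      have h3 := abs_sub_truncUnmatched_le ht0 (hdeg n) k (Finset.mem_univ v)
      rw [abs_le] at h3 ⊢
      constructor <;> linarith
    have h4 := mul_le_mul_of_nonneg_right ht (Nat.cast_nonneg (α := ℝ) (Fintype.card (V n)))
    rw [abs_le] at h1 h2 ⊢
    constructor <;> linarith
end

section
/- Let G be a graph in which every vertex has degree exactly 2, and let M be a matching in G with no k-augmenting paths for any finite k ≥ 0. Let x_0 be a vertex not matched by M and let x_0, x_1, x_2, … be an infinite path in G (consecutive vertices adjacent, all vertices distinct). Then every x_i with i ≥ 1 is matched by M, and the edge x_{2j+1}x_{2j+2} belongs to M for every j ≥ 0. Moreover, if y_0 ≠ x_0 is another vertex not matched by M and y_0, y_1, y_2, … is an infinite path in G, then x_i ≠ y_j for all i, j ≥ 1. -/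
/-- A vertex of degree two has no neighbours besides two given distinct ones. -/
theorem eq_or_eq_of_adj_of_ncard_eq_two {V : Type*} {G : SimpleGraph V} {v a b w : V}
    (hdeg : (G.neighborSet v).ncard = 2) (ha : G.Adj v a) (hb : G.Adj v b) (hab : a ≠ b)
    (hw : G.Adj v w) : w = a ∨ w = b := by
  have hsub : ({a, b} : Set V) ⊆ G.neighborSet v := by
    rintro u (rfl | rfl) <;> assumption
  have hfin : (G.neighborSet v).Finite := Set.finite_of_ncard_pos (by omega)
  have heq := Set.eq_of_subset_of_ncard_le hsub (by rw [hdeg, Set.ncard_pair hab]) hfin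
  have : w ∈ ({a, b} : Set V) := heq ▸ hw
  simpa using this

/-- In a ray of a 2-regular graph, an inner vertex is adjacent only to its two ray neighbours. -/
theorem eq_or_eq_of_adj_ray {V : Type*} {G : SimpleGraph V}
    (hdeg : ∀ v : V, (G.neighborSet v).ncard = 2) {x : ℕ → V}
    (hxinj : Function.Injective x) (hxadj : ∀ i : ℕ, G.Adj (x i) (x (i + 1)))
    (i : ℕ) {w : V} (hw : G.Adj (x (i + 1)) w) : w = x i ∨ w = x (i + 2) :=
  eq_or_eq_of_adj_of_ncard_eq_two (hdeg _) (hxadj i).symm (hxadj (i + 1))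
    (fun h => by have := hxinj h; omega) hw

/-- If the preceding odd edge of a ray from an unmatched vertex is in the matching, the even edge
is not. -/
theorem even_edge_notMem {V : Type*} {G : SimpleGraph V} {M : Set (Sym2 V)}
    (hM : IsGraphMatching G M) {x : ℕ → V} (hx0 : x 0 ∉ matchedSet M)
    (hxinj : Function.Injective x) {j : ℕ}
    (hodd : ∀ i < j, s(x (2 * i + 1), x (2 * i + 2)) ∈ M) :
    s(x (2 * j), x (2 * j + 1)) ∉ M := by
  intro h
  rcases j with _ | j
  · exact hx0 ⟨_, h, by simp⟩
  · refine hM.2 _ (hodd j (by omega)) _ h ?_ (x (2 * j + 2)) (by simp) (by simp [mul_add])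
    intro he
    rw [Sym2.eq_iff] at he
    rcases he with ⟨h1, -⟩ | ⟨h1, -⟩ <;> · have := hxinj h1; omega

/-- Without augmenting paths, all odd edges of a ray from an unmatched vertex are in the
matching. -/
theorem odd_edge_mem {V : Type*} {G : SimpleGraph V}
    (hdeg : ∀ v : V, (G.neighborSet v).ncard = 2) {M : Set (Sym2 V)}
    (hM : IsGraphMatching G M) (hnoaug : ∀ (k : ℕ) (p : ℕ → V), ¬ IsAugPath G M k p)
    {x : ℕ → V} (hx0 : x 0 ∉ matchedSet M) (hxinj : Function.Injective x)
    (hxadj : ∀ i : ℕ, G.Adj (x i) (x (i + 1))) (j : ℕ) :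
    s(x (2 * j + 1), x (2 * j + 2)) ∈ M := by
  induction j using Nat.strong_induction_on with
  | _ j ih =>
    have hmatched : x (2 * j + 1) ∈ matchedSet M := by
      by_contra hun
      exact hnoaug j x ⟨fun _ _ _ _ h => hxinj h, fun i _ => hxadj i,
        fun i hi => even_edge_notMem hM hx0 hxinj fun l hl => ih l (by omega), ih, hx0, hun⟩
    obtain ⟨e, he, hv⟩ := hmatched
    obtain ⟨w, rfl⟩ := Sym2.mem_iff_exists.mp hv
    rcases eq_or_eq_of_adj_ray hdeg hxinj hxadj (2 * j) (hM.1 he) with rfl | rfl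
    · exact absurd (Sym2.eq_swap ▸ he) (even_edge_notMem hM hx0 hxinj ih)
    · exact he

/-- If all odd edges of a path are in `M`, every vertex after the first is matched. -/
theorem mem_matchedSet_of_odd_edge_mem {V : Type*} {M : Set (Sym2 V)} {x : ℕ → V}
    (hodd : ∀ j, s(x (2 * j + 1), x (2 * j + 2)) ∈ M) (i : ℕ) : x (i + 1) ∈ matchedSet M := by
  rcases Nat.even_or_odd' i with ⟨j, rfl | rfl⟩
  · exact ⟨_, hodd j, by simp⟩
  · exact ⟨_, hodd j, by simp⟩

/-- Two rays of a 2-regular graph with distinct initial vertices outside `S`, all of whose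
later vertices lie in `S`, are disjoint past their initial vertices. -/
theorem ray_ne_ray {V : Type*} {G : SimpleGraph V}
    (hdeg : ∀ v : V, (G.neighborSet v).ncard = 2) {S : Set V} {x y : ℕ → V}
    (hxadj : ∀ i : ℕ, G.Adj (x i) (x (i + 1)))
    (hyinj : Function.Injective y) (hyadj : ∀ i : ℕ, G.Adj (y i) (y (i + 1)))
    (hne : y 0 ≠ x 0) (hx0 : x 0 ∉ S) (hy0 : y 0 ∉ S)
    (hx : ∀ i, x (i + 1) ∈ S) (hy : ∀ i, y (i + 1) ∈ S) (i j : ℕ) :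
    x (i + 1) ≠ y (j + 1) := by
  induction i generalizing j with
  | zero =>
    intro h
    rcases eq_or_eq_of_adj_ray hdeg hyinj hyadj j (h ▸ (hxadj 0).symm) with h' | h'
    · rcases j with _ | j
      · exact hne h'.symm
      · exact hx0 (h' ▸ hy j)
    · exact hx0 (h' ▸ hy (j + 1))
  | succ i ih =>
    intro h
    rcases eq_or_eq_of_adj_ray hdeg hyinj hyadj j (h ▸ (hxadj (i + 1)).symm) with h' | h'
    · rcases j with _ | j
      · exact hy0 (h' ▸ hx i)
      · exact ih j h'
    · exact ih (j + 1) h'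

/-- In a 2-regular graph with a matching `M` having no finite
augmenting paths: along any infinite path starting at an unmatched vertex, every
later vertex is matched and the odd edges of the path lie in `M`; moreover two
such paths starting at distinct unmatched vertices are disjoint from index 1 on. -/
theorem stmt8 {V : Type*} (G : SimpleGraph V)
    (hdeg : ∀ v : V, (G.neighborSet v).Finite ∧ (G.neighborSet v).ncard = 2)
    (M : Set (Sym2 V)) (hM : IsGraphMatching G M)
    (hnoaug : ∀ (k : ℕ) (p : ℕ → V), ¬ IsAugPath G M k p)
    (x : ℕ → V) (hx0 : x 0 ∉ matchedSet M)
    (hxinj : Function.Injective x) (hxadj : ∀ i : ℕ, G.Adj (x i) (x (i + 1))) :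
    (∀ i : ℕ, 1 ≤ i → x i ∈ matchedSet M) ∧
    (∀ j : ℕ, s(x (2 * j + 1), x (2 * j + 2)) ∈ M) ∧
    (∀ y : ℕ → V, y 0 ≠ x 0 → y 0 ∉ matchedSet M → Function.Injective y →
      (∀ i : ℕ, G.Adj (y i) (y (i + 1))) →
      ∀ i j : ℕ, 1 ≤ i → 1 ≤ j → x i ≠ y j) := by
  have hdeg2 := fun v => (hdeg v).2
  have hodd := odd_edge_mem hdeg2 hM hnoaug hx0 hxinj hxadj
  have hx := mem_matchedSet_of_odd_edge_mem hodd
  refine ⟨fun i hi => ?_, hodd, fun y hne hy0 hyinj hyadj i j hi hj => ?_⟩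
  · obtain ⟨i, rfl⟩ := Nat.exists_eq_add_of_le' hi
    exact hx i
  · obtain ⟨i, rfl⟩ := Nat.exists_eq_add_of_le' hi
    obtain ⟨j, rfl⟩ := Nat.exists_eq_add_of_le' hj
    have hy := mem_matchedSet_of_odd_edge_mem (odd_edge_mem hdeg2 hM hnoaug hy0 hyinj hyadj)
    exact ray_ne_ray hdeg2 hxadj hyinj hyadj hne hx0 hy0 hx hy i j
end

section
/- Let G be a graph, let M be a matching in G, and let P be the edge set of a k-augmenting path for M. Then the symmetric difference M' = M △ P is a matching in G, and the set of vertices matched by M is strictly contained in the set of vertices matched by M': X_M ⊊ X_{M'}. -/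
/-- Distinct edges of a matching share no vertex, so a common vertex forces equality. -/
theorem IsGraphMatching.eq_of_mem {V : Type*} {G : SimpleGraph V} {M : Set (Sym2 V)}
    (hM : IsGraphMatching G M) {e f : Sym2 V} (he : e ∈ M) (hf : f ∈ M) {v : V}
    (hve : v ∈ e) (hvf : v ∈ f) : e = f := by
  by_contra h
  exact hM.2 e he f hf h v hve hvf

/-- An edge of an augmenting path that is not in the matching has an even index. -/
theorem IsAugPath.exists_even_of_notMem {V : Type*} {G : SimpleGraph V} {M : Set (Sym2 V)}
    {k : ℕ} {p : ℕ → V} (hp : IsAugPath G M k p) {i : ℕ} (hi : i < 2 * k + 1)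
    (h : s(p i, p (i + 1)) ∉ M) : ∃ j ≤ k, i = 2 * j := by
  obtain ⟨j, rfl | rfl⟩ := Nat.even_or_odd' i
  · exact ⟨j, by omega, rfl⟩
  · exact absurd (hp.2.2.2.1 j (by omega)) h

/-- A matching edge that meets an augmenting path is an edge of that path. -/
theorem IsAugPath.exists_eq_of_mem {V : Type*} {G : SimpleGraph V} {M : Set (Sym2 V)}
    (hM : IsGraphMatching G M) {k : ℕ} {p : ℕ → V} (hp : IsAugPath G M k p)
    {e : Sym2 V} (he : e ∈ M) {i : ℕ} (hi : i ≤ 2 * k + 1) (hie : p i ∈ e) :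
    ∃ l < 2 * k + 1, e = s(p l, p (l + 1)) := by
  obtain ⟨-, -, -, hodd, hfirst, hlast⟩ := hp
  have hi0 : i ≠ 0 := by
    rintro rfl
    exact hfirst ⟨e, he, hie⟩
  have hik : i ≠ 2 * k + 1 := by
    rintro rfl
    exact hlast ⟨e, he, hie⟩
  obtain ⟨j, rfl | rfl⟩ := Nat.even_or_odd' i
  · obtain ⟨j, rfl⟩ : ∃ m, j = m + 1 := ⟨j - 1, by omega⟩
    exact ⟨2 * j + 1, by omega,
      hM.eq_of_mem he (hodd j (by omega)) hie (Sym2.mem_mk_right _ _)⟩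
  · exact ⟨2 * j + 1, by omega,
      hM.eq_of_mem he (hodd j (by omega)) hie (Sym2.mem_mk_left _ _)⟩

/-- If `P` is the edge set of a `k`-augmenting path for a
matching `M` in `G`, then `M △ P` is again a matching, and it matches a strictly
larger set of vertices. -/
theorem stmt9 {V : Type*} (G : SimpleGraph V) (M : Set (Sym2 V))
    (hM : IsGraphMatching G M) (k : ℕ) (p : ℕ → V) (hp : IsAugPath G M k p)
    (P : Set (Sym2 V)) (hP : P = {e : Sym2 V | ∃ i < 2 * k + 1, e = s(p i, p (i + 1))}) :
    IsGraphMatching G (symmDiff M P) ∧ matchedSet M ⊂ matchedSet (symmDiff M P) := by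
  have hmeet : ∀ e ∈ M, ∀ i ≤ 2 * k + 1, p i ∈ e → e ∈ P := by
    intro e he i hi hie
    rw [hP]
    exact hp.exists_eq_of_mem hM he hi hie
  have heven : ∀ e ∈ P, e ∉ M → ∃ j ≤ k, e = s(p (2 * j), p (2 * j + 1)) := by
    intro e he heM
    rw [hP] at he
    obtain ⟨i, hi, rfl⟩ := he
    obtain ⟨j, hj, rfl⟩ := hp.exists_even_of_notMem hi heM
    exact ⟨j, hj, rfl⟩
  have hcover : ∀ i ≤ 2 * k + 1, p i ∈ matchedSet (symmDiff M P) := by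
    intro i hi
    refine ⟨s(p (2 * (i / 2)), p (2 * (i / 2) + 1)),
      Or.inr ⟨?_, hp.2.2.1 (i / 2) (by omega)⟩, ?_⟩
    · rw [hP]
      exact ⟨2 * (i / 2), by omega, rfl⟩
    · rcases Nat.mod_two_eq_zero_or_one i with h | h
      · rw [show 2 * (i / 2) = i by omega]
        exact Sym2.mem_mk_left _ _
      · rw [show 2 * (i / 2) + 1 = i by omega]
        exact Sym2.mem_mk_right _ _
  have hdisj : ∀ e ∈ M, e ∉ P → ∀ f ∈ P, f ∉ M → ∀ v ∈ e, v ∉ f := by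
    intro e he heP f hf hfM v hve hvf
    obtain ⟨j, hj, rfl⟩ := heven f hf hfM
    rcases Sym2.mem_iff.1 hvf with rfl | rfl
    · exact heP (hmeet e he _ (by omega) hve)
    · exact heP (hmeet e he _ (by omega) hve)
  refine ⟨⟨?_, ?_⟩, ?_⟩
  · rintro e (⟨he, -⟩ | ⟨he, -⟩)
    · exact hM.1 he
    · rw [hP] at he
      obtain ⟨i, hi, rfl⟩ := he
      exact hp.2.1 i hi
  · rintro e (⟨he, he'⟩ | ⟨he, he'⟩) f (⟨hf, hf'⟩ | ⟨hf, hf'⟩) hef v hve hvf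
    · exact hM.2 e he f hf hef v hve hvf
    · exact hdisj e he he' f hf hf' v hve hvf
    · exact hdisj f hf hf' e he he' v hvf hve
    · obtain ⟨a, ha, rfl⟩ := heven e he he'
      obtain ⟨b, hb, rfl⟩ := heven f hf hf'
      have hab : a = b := by
        rcases Sym2.mem_iff.1 hve with h | h <;> rcases Sym2.mem_iff.1 hvf with h' | h' <;>
          have := hp.1 _ (by omega) _ (by omega) (h.symm.trans h') <;> omega
      exact hef (by rw [hab])
  · refine (Set.ssubset_iff_of_subset ?_).2 ⟨p 0, hcover 0 (by omega), hp.2.2.2.2.1⟩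
    rintro v ⟨e, he, hve⟩
    by_cases heP : e ∈ P
    · rw [hP] at heP
      obtain ⟨i, hi, rfl⟩ := heP
      rcases Sym2.mem_iff.1 hve with rfl | rfl
      · exact hcover _ (by omega)
      · exact hcover _ (by omega)
    · exact ⟨e, Or.inl ⟨he, heP⟩, hve⟩
end
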